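/- Let D_s = −∫_{1/√3}^∞ f_{4,6}((1+iy)/2) y^{s−1} dy and E_s = −∫_{1/√3}^∞ g_{4,6}((1+iy)/2) y^{s−1} dy for s = 1, 2. Then the Legendre-type relation D₁E₂ − D₂E₁ = 1/(24π³) holds between the periods D_s of f_{4,6} and the quasi-periods E_s coming from the weakly holomorphic form g_{4,6}. -/

import Mathlib

open scoped BigOperators Real

/-- The Dedekind eta function `η(z) = e^{πiz/12} ∏_{n≥1} (1 - e^{2πinz})`. -/
noncomputable def dedekindEta (z : ℂ) : ℂ :=
  Complex.exp (Real.pi * Complex.I * z / 12) *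
    ∏' n : ℕ, (1 - Complex.exp (2 * Real.pi * Complex.I * ((n : ℂ) + 1) * z))

/-- The weight-4 level-6 cusp form `f_{4,6}(z) = (η(z)η(2z)η(3z)η(6z))²`. -/
noncomputable def f46 (z : ℂ) : ℂ :=
  (dedekindEta z * dedekindEta (2 * z) * dedekindEta (3 * z) * dedekindEta (6 * z)) ^ 2

/-- The Hauptmodul-type quotient `w(z) = 3η(2z)²η(3z)⁴/(η(z)⁴η(6z)²)`. -/
noncomputable def w46 (z : ℂ) : ℂ :=
  3 * dedekindEta (2 * z) ^ 2 * dedekindEta (3 * z) ^ 4 /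
    (dedekindEta z ^ 4 * dedekindEta (6 * z) ^ 2)

/-- The weakly holomorphic weight-4 modular form
`g_{4,6}(z) = ((w² - 3)²(w⁴ + 9)/(8w⁴))·f_{4,6}(z)`. -/
noncomputable def g46 (z : ℂ) : ℂ :=
  ((w46 z ^ 2 - 3) ^ 2 * (w46 z ^ 4 + 9) / (8 * w46 z ^ 4)) * f46 z

/-- The period Eichler integrals `D_s = -∫_{1/√3}^∞ f_{4,6}((1+iy)/2) y^{s-1} dy`. -/
noncomputable def D (s : ℕ) : ℂ :=
  -∫ y in Set.Ioi (1 / Real.sqrt 3), f46 ((1 + Complex.I * (y : ℂ)) / 2) * (y : ℂ) ^ (s - 1)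

/-- The quasi-period Eichler integrals `E_s = -∫_{1/√3}^∞ g_{4,6}((1+iy)/2) y^{s-1} dy`. -/
noncomputable def E (s : ℕ) : ℂ :=
  -∫ y in Set.Ioi (1 / Real.sqrt 3), g46 ((1 + Complex.I * (y : ℂ)) / 2) * (y : ℂ) ^ (s - 1)

open Complex Set Filter Topology

/-- The Euler product `∏ (1 - q^n)`. -/
noncomputable def eulerProd (q : ℂ) : ℂ := ∏' n : ℕ, (1 - q ^ (n + 1))

/-- The nome `q = e^{2πiz}`. -/
noncomputable def nome (z : ℂ) : ℂ := cexp (2 * π * I * z)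

/-- The square of the Dedekind eta function. -/
noncomputable def etaSq (z : ℂ) : ℂ := dedekindEta z ^ 2

lemma dedekindEta_eq_eta (z : ℂ) : dedekindEta z = ModularForm.eta z := by
  unfold dedekindEta ModularForm.eta
  congr 1
  · simp only [Function.Periodic.qParam]
    congr 1
    push_cast
    ring
  · congr 1
    ext n
    rw [ModularForm.eta_q_eq_cexp]

lemma etaSq_eq (z : ℂ) : etaSq z = cexp (π * I * z / 6) * eulerProd (nome z) ^ 2 := by
  unfold etaSq dedekindEta eulerProd nome
  rw [mul_pow, ← Complex.exp_nat_mul]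
  congr 1
  · congr 1
    push_cast
    ring
  · congr 2
    ext n
    rw [← Complex.exp_nat_mul]
    congr 2
    push_cast
    ring

lemma etaSq_ne_zero {z : ℂ} (hz : 0 < z.im) : etaSq z ≠ 0 := by
  unfold etaSq
  rw [dedekindEta_eq_eta]
  exact pow_ne_zero _ (ModularForm.eta_ne_zero hz)

lemma differentiableAt_etaSq {z : ℂ} (hz : 0 < z.im) : DifferentiableAt ℂ etaSq z := by
  have h : etaSq = fun z => ModularForm.eta z ^ 2 := by
    ext z
    rw [etaSq, dedekindEta_eq_eta]
  rw [h]
  exact (ModularForm.differentiableAt_eta_of_mem_upperHalfPlaneSet hz).pow 2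

lemma im_neg_one_div {z : ℂ} (hz : 0 < z.im) : 0 < (-1 / z).im := by
  have h0 : z ≠ 0 := by
    rintro rfl
    simp at hz
  have : (-1 / z).im = z.im / Complex.normSq z := by
    rw [div_eq_mul_inv, neg_one_mul, Complex.neg_im, Complex.inv_im]
    ring
  rw [this]
  exact div_pos hz (Complex.normSq_pos.mpr h0)

lemma etaSq_neg_one_div {z : ℂ} (hz : 0 < z.im) : etaSq (-1 / z) = -I * z * etaSq z := by
  have h := ModularForm.eta_comp_eq_csqrt_I_inv (show z ∈ UpperHalfPlane.upperHalfPlaneSet from hz)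
  simp only [Function.comp_apply, Pi.smul_apply, Pi.mul_apply, smul_eq_mul] at h
  have h0 : z ≠ 0 := by
    rintro rfl
    simp at hz
  have hs : ∀ w : ℂ, w ≠ 0 → Complex.sqrt w ^ 2 = w := by
    intro w hw
    rw [Complex.sqrt, ← Complex.cpow_nat_mul]
    simp
  unfold etaSq
  rw [dedekindEta_eq_eta, dedekindEta_eq_eta, h, mul_pow, mul_pow, inv_pow, hs z h0,
    hs I I_ne_zero, Complex.inv_I]
  ring

lemma nome_add_one (z : ℂ) : nome (z + 1) = nome z := by
  unfold nome
  rw [show 2 * (π : ℂ) * I * (z + 1) = 2 * π * I * z + 2 * π * I by ring, Complex.exp_add,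
    Complex.exp_two_pi_mul_I, mul_one]

lemma etaSq_add_one (z : ℂ) : etaSq (z + 1) = cexp (π * I / 6) * etaSq z := by
  rw [etaSq_eq, etaSq_eq, nome_add_one, ← mul_assoc, ← Complex.exp_add]
  congr 2
  ring

/-- The multiplier `e^{πi/6}` of `etaSq` under translation. -/
noncomputable def zetaT : ℂ := cexp (π * I / 6)

lemma zetaT_ne_zero : zetaT ≠ 0 := Complex.exp_ne_zero _

lemma zetaT_pow_three : zetaT ^ 3 = I := by
  unfold zetaT
  rw [← Complex.exp_nat_mul]
  refine Eq.trans ?_ Complex.exp_pi_div_two_mul_I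
  congr 1
  push_cast
  ring

lemma etaSq_sub_one (z : ℂ) : etaSq (z - 1) = zetaT⁻¹ * etaSq z := by
  have h := etaSq_add_one (z - 1)
  rw [sub_add_cancel] at h
  change etaSq z = zetaT * _ at h
  rw [h, inv_mul_cancel_left₀ zetaT_ne_zero]

lemma etaSq_half {z : ℂ} (hz : 0 < z.im) :
    etaSq ((-1 / z + 1) / 2) = -I * z * etaSq ((z + 1) / 2) := by
  have h0 : z ≠ 0 := by
    rintro rfl
    simp at hz
  have hm : (0 : ℝ) < ((z - 1) / 2).im := by
    have : ((z - 1) / 2).im = z.im / 2 := by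
      simp
    rw [this]; positivity
  have hm0 : (z - 1) ≠ 0 := by
    intro h
    rw [h] at hm
    simp at hm
  have h1 := etaSq_neg_one_div hm
  have him : 0 < (-1 / ((z - 1) / 2)).im := im_neg_one_div hm
  have him2 : 0 < (-1 / ((z - 1) / 2) - 1 - 1).im := by simpa using him
  have h2 := etaSq_neg_one_div him2
  have e1 : -1 / (-1 / ((z - 1) / 2) - 1 - 1) = (-1 / z + 1) / 2 := by
    have : -1 / ((z - 1) / 2) - 1 - 1 = -2 * z / (z - 1) := by
      field_simp
      ring
    rw [this]
    field_simp
    ring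
  have e2 : (z - 1) / 2 = (z + 1) / 2 - 1 := by ring
  rw [e1, etaSq_sub_one, etaSq_sub_one, h1, e2, etaSq_sub_one] at h2
  rw [h2]
  have hz3 : zetaT⁻¹ * (zetaT⁻¹ * zetaT⁻¹) = -I := by
    rw [← Complex.inv_I, ← zetaT_pow_three]
    field_simp
  have : -1 / ((z + 1) / 2 - 1) - 1 - 1 = -2 * z / (z - 1) := by
    rw [← e2]
    field_simp
    ring
  rw [this]
  calc _ = (zetaT⁻¹ * (zetaT⁻¹ * zetaT⁻¹)) * (I * I) * z * ((-2) / (z - 1) * ((z + 1) / 2 - 1))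
        * etaSq ((z + 1) / 2) := by ring
    _ = _ := by
      rw [hz3, Complex.I_mul_I, ← e2]
      field_simp
      try ring

/-- The rational function relating the weakly holomorphic form to the cusp form. -/
noncomputable def ratPhi (x : ℂ) : ℂ := (x - 3) ^ 2 * (x ^ 2 + 9) / (8 * x ^ 2)

lemma ratPhi_nine_div {x : ℂ} (hx : x ≠ 0) : ratPhi (9 / x) = ratPhi x := by
  unfold ratPhi
  field_simp
  ring

/-- The square of `w46`, written with `etaSq`. -/
noncomputable def uInf (z : ℂ) : ℂ :=
  9 * etaSq (2 * z) ^ 2 * etaSq (3 * z) ^ 4 / (etaSq z ^ 4 * etaSq (6 * z) ^ 2)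

/-- The transform of `uInf` under the Fricke involution of level six. -/
noncomputable def uZero (z : ℂ) : ℂ :=
  etaSq (2 * z) ^ 4 * etaSq (3 * z) ^ 2 / (etaSq (6 * z) ^ 4 * etaSq z ^ 2)

/-- The transform of `g46` under the Fricke involution of level six. -/
noncomputable def k46 (z : ℂ) : ℂ := ratPhi (uZero z) * f46 z

lemma f46_eq (z : ℂ) : f46 z = etaSq z * etaSq (2 * z) * etaSq (3 * z) * etaSq (6 * z) := by
  unfold f46 etaSq
  ring

lemma g46_eq (z : ℂ) : g46 z = ratPhi (uInf z) * f46 z := by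
  have : uInf z = w46 z ^ 2 := by
    unfold uInf w46 etaSq
    rw [div_pow]
    congr 1 <;> ring
  unfold g46 ratPhi
  rw [this]
  ring

lemma im_nat_mul {z : ℂ} (n : ℕ) [n.AtLeastTwo] (hz : 0 < z.im) :
    0 < ((OfNat.ofNat n : ℂ) * z).im := by
  have : ((OfNat.ofNat n : ℂ) * z).im = (n : ℝ) * z.im := by
    change (((n : ℕ) : ℂ) * z).im = _
    simp
  rw [this]
  have : 0 < n := by
    have := Nat.AtLeastTwo.prop (n := n)
    omega
  positivity

lemma ne_zero_of_im_pos {z : ℂ} (hz : 0 < z.im) : z ≠ 0 := by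
  rintro rfl
  simp at hz

lemma etaSq_fricke {z : ℂ} (a b : ℂ) (ha : a ≠ 0) (hz : 0 < (b * z).im) :
    etaSq (a * (-1 / (a * b * z))) = -I * (b * z) * etaSq (b * z) := by
  rw [← etaSq_neg_one_div hz]
  congr 1
  have := ne_zero_of_im_pos hz
  field_simp

lemma etaSq_fricke_six {z : ℂ} (hz : 0 < z.im) :
    etaSq (-1 / (6 * z)) = -I * (6 * z) * etaSq (6 * z) ∧
    etaSq (2 * (-1 / (6 * z))) = -I * (3 * z) * etaSq (3 * z) ∧
    etaSq (3 * (-1 / (6 * z))) = -I * (2 * z) * etaSq (2 * z) ∧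
    etaSq (6 * (-1 / (6 * z))) = -I * z * etaSq z := by
  refine ⟨etaSq_neg_one_div (im_nat_mul 6 hz), ?_, ?_, ?_⟩
  · have := etaSq_fricke 2 3 (by norm_num) (im_nat_mul 3 hz)
    norm_num at this ⊢
    exact this
  · have := etaSq_fricke 3 2 (by norm_num) (im_nat_mul 2 hz)
    norm_num at this ⊢
    exact this
  · have := etaSq_fricke (z := z) 6 1 (by norm_num) (by simpa using hz)
    norm_num at this ⊢
    exact this

lemma f46_fricke {z : ℂ} (hz : 0 < z.im) : f46 (-1 / (6 * z)) = 36 * z ^ 4 * f46 z := by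
  obtain ⟨h1, h2, h3, h4⟩ := etaSq_fricke_six hz
  rw [f46_eq, f46_eq, h1, h2, h3, h4]
  linear_combination 36 * z ^ 4 * (etaSq z * etaSq (2 * z) * etaSq (3 * z) * etaSq (6 * z)) *
    Complex.I_pow_four

lemma uInf_fricke {z : ℂ} (hz : 0 < z.im) : uInf (-1 / (6 * z)) = uZero z := by
  obtain ⟨h1, h2, h3, h4⟩ := etaSq_fricke_six hz
  have := ne_zero_of_im_pos hz
  have := etaSq_ne_zero hz
  have := etaSq_ne_zero (im_nat_mul 6 hz)
  unfold uInf uZero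
  rw [h1, h2, h3, h4]
  have := I_ne_zero
  field_simp
  try ring

lemma im_neg_one_div_six {z : ℂ} (hz : 0 < z.im) : 0 < (-1 / (6 * z)).im :=
  im_neg_one_div (im_nat_mul 6 hz)

lemma im_neg_one_div_three {z : ℂ} (hz : 0 < z.im) : 0 < (-1 / (3 * z)).im :=
  im_neg_one_div (im_nat_mul 3 hz)

lemma g46_fricke {z : ℂ} (hz : 0 < z.im) : g46 (-1 / (6 * z)) = 36 * z ^ 4 * k46 z := by
  rw [g46_eq, f46_fricke hz, uInf_fricke hz, k46]
  ring

lemma k46_fricke {z : ℂ} (hz : 0 < z.im) : k46 (-1 / (6 * z)) = 36 * z ^ 4 * g46 z := by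
  have h := g46_fricke (im_neg_one_div_six hz)
  have h0 := ne_zero_of_im_pos hz
  have e : -1 / (6 * (-1 / (6 * z))) = z := by
    field_simp
  rw [e] at h
  rw [h]
  field_simp
  ring

lemma etaSq_add_nat (z : ℂ) (n : ℕ) : etaSq (z + n) = zetaT ^ n * etaSq z := by
  induction n with
  | zero => simp
  | succ n ih =>
    push_cast
    rw [← add_assoc, etaSq_add_one, ih]
    change zetaT * _ = _
    ring

lemma etaSq_mul_add_one (z : ℂ) :
    etaSq (2 * (z + 1)) = zetaT ^ 2 * etaSq (2 * z) ∧
    etaSq (3 * (z + 1)) = zetaT ^ 3 * etaSq (3 * z) ∧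
    etaSq (6 * (z + 1)) = zetaT ^ 6 * etaSq (6 * z) := by
  refine ⟨?_, ?_, ?_⟩
  · rw [← etaSq_add_nat]; congr 1; push_cast; ring
  · rw [← etaSq_add_nat]; congr 1; push_cast; ring
  · rw [← etaSq_add_nat]; congr 1; push_cast; ring

lemma zetaT_pow_twelve : zetaT ^ 12 = 1 := by
  have : zetaT ^ 12 = (zetaT ^ 3) ^ 4 := by ring
  rw [this, zetaT_pow_three, Complex.I_pow_four]

lemma f46_add_one (z : ℂ) : f46 (z + 1) = f46 z := by
  obtain ⟨h2, h3, h6⟩ := etaSq_mul_add_one z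
  have h1 : etaSq (z + 1) = zetaT * etaSq z := etaSq_add_one z
  rw [f46_eq, f46_eq, h1, h2, h3, h6]
  linear_combination (etaSq z * etaSq (2 * z) * etaSq (3 * z) * etaSq (6 * z)) * zetaT_pow_twelve

lemma uInf_add_one (z : ℂ) : uInf (z + 1) = uInf z := by
  obtain ⟨h2, h3, h6⟩ := etaSq_mul_add_one z
  have h1 : etaSq (z + 1) = zetaT * etaSq z := etaSq_add_one z
  unfold uInf
  rw [h1, h2, h3, h6]
  have := zetaT_ne_zero
  rw [show 9 * (zetaT ^ 2 * etaSq (2 * z)) ^ 2 * (zetaT ^ 3 * etaSq (3 * z)) ^ 4 =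
    zetaT ^ 16 * (9 * etaSq (2 * z) ^ 2 * etaSq (3 * z) ^ 4) by ring,
    show (zetaT * etaSq z) ^ 4 * (zetaT ^ 6 * etaSq (6 * z)) ^ 2 =
    zetaT ^ 16 * (etaSq z ^ 4 * etaSq (6 * z) ^ 2) by ring,
    mul_div_mul_left _ _ (pow_ne_zero _ this)]

lemma uZero_add_one (z : ℂ) : uZero (z + 1) = uZero z := by
  obtain ⟨h2, h3, h6⟩ := etaSq_mul_add_one z
  have h1 : etaSq (z + 1) = zetaT * etaSq z := etaSq_add_one z
  unfold uZero
  rw [h1, h2, h3, h6]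
  have := zetaT_ne_zero
  rw [show (zetaT ^ 6 * etaSq (6 * z)) ^ 4 * (zetaT * etaSq z) ^ 2 =
    zetaT ^ 14 * (zetaT ^ 12 * (etaSq (6 * z) ^ 4 * etaSq z ^ 2)) by ring,
    show (zetaT ^ 2 * etaSq (2 * z)) ^ 4 * (zetaT ^ 3 * etaSq (3 * z)) ^ 2 =
    zetaT ^ 14 * (etaSq (2 * z) ^ 4 * etaSq (3 * z) ^ 2) by ring,
    mul_div_mul_left _ _ (pow_ne_zero _ this), zetaT_pow_twelve, one_mul]

lemma g46_add_one (z : ℂ) : g46 (z + 1) = g46 z := by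
  rw [g46_eq, g46_eq, uInf_add_one, f46_add_one]

lemma k46_add_one (z : ℂ) : k46 (z + 1) = k46 z := by
  rw [k46, k46, uZero_add_one, f46_add_one]

lemma etaSq_half_arg (z : ℂ) :
    etaSq (2 * ((z + 1) / 2)) = zetaT * etaSq z ∧
    etaSq (3 * ((z + 1) / 2)) = zetaT * etaSq ((3 * z + 1) / 2) ∧
    etaSq (6 * ((z + 1) / 2)) = zetaT ^ 3 * etaSq (3 * z) := by
  refine ⟨?_, ?_, ?_⟩
  · rw [show 2 * ((z + 1) / 2) = z + 1 by ring]
    exact etaSq_add_one z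
  · rw [show 3 * ((z + 1) / 2) = (3 * z + 1) / 2 + 1 by ring]
    exact etaSq_add_one _
  · rw [← etaSq_add_nat]; congr 1; push_cast; ring

lemma f46_half (z : ℂ) : f46 ((z + 1) / 2) =
    zetaT ^ 5 * etaSq ((z + 1) / 2) * etaSq z * etaSq ((3 * z + 1) / 2) * etaSq (3 * z) := by
  obtain ⟨h2, h3, h6⟩ := etaSq_half_arg z
  rw [f46_eq, h2, h3, h6]
  ring

lemma uZero_half (z : ℂ) : uZero ((z + 1) / 2) =
    -(etaSq z ^ 4 * etaSq ((3 * z + 1) / 2) ^ 2 /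
      (etaSq (3 * z) ^ 4 * etaSq ((z + 1) / 2) ^ 2)) := by
  obtain ⟨h2, h3, h6⟩ := etaSq_half_arg z
  rw [uZero, h2, h3, h6]
  have hz : zetaT ^ 6 = -1 := by
    rw [show zetaT ^ 6 = (zetaT ^ 3) ^ 2 by ring, zetaT_pow_three, I_sq]
  rw [show (zetaT * etaSq z) ^ 4 * (zetaT * etaSq ((3 * z + 1) / 2)) ^ 2 =
      -(etaSq z ^ 4 * etaSq ((3 * z + 1) / 2) ^ 2) by
    linear_combination (etaSq z ^ 4 * etaSq ((3 * z + 1) / 2) ^ 2) * hz,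
    show (zetaT ^ 3 * etaSq (3 * z)) ^ 4 * etaSq ((z + 1) / 2) ^ 2 =
      etaSq (3 * z) ^ 4 * etaSq ((z + 1) / 2) ^ 2 by
    linear_combination (etaSq (3 * z) ^ 4 * etaSq ((z + 1) / 2) ^ 2) * zetaT_pow_twelve,
    neg_div]

lemma im_half {z : ℂ} (hz : 0 < z.im) : 0 < ((z + 1) / 2).im := by
  have : ((z + 1) / 2).im = z.im / 2 := by simp
  rw [this]; positivity

lemma im_half' {z : ℂ} (hz : 0 < z.im) : 0 < (z / 2).im := by
  have : (z / 2).im = z.im / 2 := by simp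
  rw [this]; positivity

lemma etaSq_fricke_half {z : ℂ} (hz : 0 < z.im) :
    etaSq (-1 / (3 * z)) = -I * (3 * z) * etaSq (3 * z) ∧
    etaSq (3 * (-1 / (3 * z))) = -I * z * etaSq z ∧
    etaSq ((-1 / (3 * z) + 1) / 2) = -I * (3 * z) * etaSq ((3 * z + 1) / 2) ∧
    etaSq ((3 * (-1 / (3 * z)) + 1) / 2) = -I * z * etaSq ((z + 1) / 2) := by
  have e : 3 * (-1 / (3 * z)) = -1 / z := by
    have := ne_zero_of_im_pos hz
    field_simp
  rw [e]
  exact ⟨etaSq_neg_one_div (im_nat_mul 3 hz), etaSq_neg_one_div hz,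
    etaSq_half (im_nat_mul 3 hz), etaSq_half hz⟩

lemma f46_half_fricke {z : ℂ} (hz : 0 < z.im) :
    f46 ((-1 / (3 * z) + 1) / 2) = 9 * z ^ 4 * f46 ((z + 1) / 2) := by
  obtain ⟨h1, h2, h3, h4⟩ := etaSq_fricke_half hz
  rw [f46_half, f46_half, h1, h2, h3, h4]
  linear_combination 9 * z ^ 4 * (zetaT ^ 5 * etaSq ((z + 1) / 2) * etaSq z *
    etaSq ((3 * z + 1) / 2) * etaSq (3 * z)) * Complex.I_pow_four

lemma uZero_half_fricke {z : ℂ} (hz : 0 < z.im) :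
    uZero ((-1 / (3 * z) + 1) / 2) = 9 / uZero ((z + 1) / 2) := by
  obtain ⟨h1, h2, h3, h4⟩ := etaSq_fricke_half hz
  rw [uZero_half, uZero_half, h1, h2, h3, h4]
  have := ne_zero_of_im_pos hz
  have := etaSq_ne_zero hz
  have := etaSq_ne_zero (im_nat_mul 3 hz)
  have := etaSq_ne_zero (im_half hz)
  have := etaSq_ne_zero (im_half (im_nat_mul 3 hz))
  have := I_ne_zero
  field_simp
  try norm_num

lemma uZero_ne_zero {z : ℂ} (hz : 0 < z.im) : uZero z ≠ 0 := by
  have := etaSq_ne_zero hz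
  have := etaSq_ne_zero (im_nat_mul 2 hz)
  have := etaSq_ne_zero (im_nat_mul 3 hz)
  have := etaSq_ne_zero (im_nat_mul 6 hz)
  unfold uZero
  positivity

lemma k46_half_fricke {z : ℂ} (hz : 0 < z.im) :
    k46 ((-1 / (3 * z) + 1) / 2) = 9 * z ^ 4 * k46 ((z + 1) / 2) := by
  rw [k46, k46, uZero_half_fricke hz, ratPhi_nine_div (uZero_ne_zero (im_half hz)),
    f46_half_fricke hz]
  ring

lemma eulerProd_zero : eulerProd 0 = 1 := by
  simp [eulerProd]

lemma differentiableOn_eulerProd : DifferentiableOn ℂ eulerProd (Metric.ball 0 1) :=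
  ModularForm.differentiableOn_tprod_one_sub_pow

lemma one_sub_pow_ne_zero {q : ℂ} (hq : ‖q‖ < 1) (n : ℕ) : 1 - q ^ (n + 1) ≠ 0 := by
  intro h
  have h1 : ‖q ^ (n + 1)‖ = 1 := by
    rw [← sub_eq_zero.mp h, norm_one]
  rw [norm_pow] at h1
  exact absurd h1 (pow_lt_one₀ (norm_nonneg _) hq (by omega)).ne

lemma eulerProd_ne_zero {q : ℂ} (hq : ‖q‖ < 1) : eulerProd q ≠ 0 := by
  unfold eulerProd
  simp_rw [sub_eq_add_neg]
  refine tprod_one_add_ne_zero_of_summable (f := fun n : ℕ => -q ^ (n + 1)) ?_ ?_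
  · intro n
    simpa [sub_eq_add_neg] using one_sub_pow_ne_zero hq n
  · simpa using (summable_nat_add_iff 1).mpr (summable_geometric_of_lt_one (norm_nonneg _) hq)

lemma hasDerivAt_eulerProd_zero : HasDerivAt eulerProd (-1) 0 := by
  have hmem : (0 : ℂ) ∈ Metric.ball (0 : ℂ) 1 := by simp
  have hl : ∀ n : ℕ, logDeriv (fun q : ℂ => 1 - q ^ (n + 1)) 0 = if n = 0 then -1 else 0 := by
    intro n
    have hd : HasDerivAt (fun q : ℂ => 1 - q ^ (n + 1)) (-(((n + 1 : ℕ) : ℂ) * 0 ^ n)) 0 := by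
      simpa using (hasDerivAt_pow (n + 1) (0 : ℂ)).const_sub 1
    rw [logDeriv_apply, hd.deriv]
    rcases n with _ | n <;> simp
  have h := logDeriv_tprod_eq_tsum (f := fun (n : ℕ) (q : ℂ) => 1 - q ^ (n + 1))
    Metric.isOpen_ball hmem (fun n => by simp) (fun n => by fun_prop) (by
      simp_rw [hl]
      exact (hasSum_ite_eq 0 (-1 : ℂ)).summable)
    ModularForm.multipliableLocallyUniformlyOn_one_sub_pow
    (eulerProd_ne_zero (by simp))
  simp_rw [hl] at h
  rw [tsum_ite_eq, logDeriv_apply] at h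
  have hd : DifferentiableAt ℂ eulerProd 0 :=
    differentiableOn_eulerProd.differentiableAt (Metric.isOpen_ball.mem_nhds hmem)
  have h2 : deriv eulerProd 0 / eulerProd 0 = -1 := h
  rw [eulerProd_zero, div_one] at h2
  rw [← h2]
  exact hd.hasDerivAt

lemma norm_pow_lt_one {q : ℂ} (hq : ‖q‖ < 1) {n : ℕ} (hn : n ≠ 0) : ‖q ^ n‖ < 1 := by
  rw [norm_pow]
  exact pow_lt_one₀ (norm_nonneg _) hq hn

lemma eulerProd_pow_ne_zero {q : ℂ} (hq : ‖q‖ < 1) {n : ℕ} (hn : n ≠ 0) :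
    eulerProd (q ^ n) ≠ 0 :=
  eulerProd_ne_zero (norm_pow_lt_one hq hn)

lemma differentiableOn_eulerProd_pow {n : ℕ} (hn : n ≠ 0) :
    DifferentiableOn ℂ (fun q => eulerProd (q ^ n)) (Metric.ball 0 1) := by
  refine differentiableOn_eulerProd.comp (by fun_prop) ?_
  intro q hq
  simp only [Metric.mem_ball, dist_zero_right] at hq ⊢
  exact norm_pow_lt_one hq hn

lemma hasDerivAt_eulerProd_pow_zero {n : ℕ} (hn : 2 ≤ n) :
    HasDerivAt (fun q => eulerProd (q ^ n)) 0 0 := by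
  have h0 : (0 : ℂ) ^ n = 0 := by
    rw [zero_pow]; omega
  have h1 : HasDerivAt (fun q : ℂ => q ^ n) 0 0 := by
    have := hasDerivAt_pow n (0 : ℂ)
    rwa [zero_pow (by omega), mul_zero] at this
  have h2 : HasDerivAt eulerProd (-1) ((0 : ℂ) ^ n) := by
    rw [h0]; exact hasDerivAt_eulerProd_zero
  have := h2.comp (0 : ℂ) h1
  rwa [mul_zero] at this

/-- The `q`-series of `f46` divided by `q`. -/
noncomputable def fSer (q : ℂ) : ℂ :=
  (eulerProd q * eulerProd (q ^ 2) * eulerProd (q ^ 3) * eulerProd (q ^ 6)) ^ 2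

/-- The `q`-series of `uInf`. -/
noncomputable def uSer (q : ℂ) : ℂ :=
  9 * eulerProd (q ^ 2) ^ 4 * eulerProd (q ^ 3) ^ 8 /
    (eulerProd q ^ 8 * eulerProd (q ^ 6) ^ 4)

/-- The `q`-series of `g46` divided by `q`. -/
noncomputable def gSer (q : ℂ) : ℂ := ratPhi (uSer q) * fSer q

/-- The `q`-series of `uZero` multiplied by `q`. -/
noncomputable def vSer (q : ℂ) : ℂ :=
  eulerProd (q ^ 2) ^ 8 * eulerProd (q ^ 3) ^ 4 /
    (eulerProd (q ^ 6) ^ 8 * eulerProd q ^ 4)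

/-- The `q`-series of `k46` multiplied by `q`. -/
noncomputable def kSer (q : ℂ) : ℂ :=
  (vSer q - 3 * q) ^ 2 * (vSer q ^ 2 + 9 * q ^ 2) / (8 * vSer q ^ 2) * fSer q

lemma differentiableOn_fSer : DifferentiableOn ℂ fSer (Metric.ball 0 1) := by
  have h1 := differentiableOn_eulerProd
  have h2 := differentiableOn_eulerProd_pow (n := 2) (by norm_num)
  have h3 := differentiableOn_eulerProd_pow (n := 3) (by norm_num)
  have h6 := differentiableOn_eulerProd_pow (n := 6) (by norm_num)
  unfold fSer
  fun_prop

lemma uSer_ne_zero {q : ℂ} (hq : ‖q‖ < 1) : uSer q ≠ 0 := by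
  have := eulerProd_ne_zero hq
  have := eulerProd_pow_ne_zero hq (n := 2) (by norm_num)
  have := eulerProd_pow_ne_zero hq (n := 3) (by norm_num)
  have := eulerProd_pow_ne_zero hq (n := 6) (by norm_num)
  exact div_ne_zero (mul_ne_zero (mul_ne_zero (by norm_num) (by positivity)) (by positivity))
    (by positivity)

lemma vSer_ne_zero {q : ℂ} (hq : ‖q‖ < 1) : vSer q ≠ 0 := by
  have := eulerProd_ne_zero hq
  have := eulerProd_pow_ne_zero hq (n := 2) (by norm_num)
  have := eulerProd_pow_ne_zero hq (n := 3) (by norm_num)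
  have := eulerProd_pow_ne_zero hq (n := 6) (by norm_num)
  unfold vSer
  positivity

lemma differentiableOn_uSer : DifferentiableOn ℂ uSer (Metric.ball 0 1) := by
  have h1 := differentiableOn_eulerProd
  have h2 := differentiableOn_eulerProd_pow (n := 2) (by norm_num)
  have h3 := differentiableOn_eulerProd_pow (n := 3) (by norm_num)
  have h6 := differentiableOn_eulerProd_pow (n := 6) (by norm_num)
  refine DifferentiableOn.div (by fun_prop) (by fun_prop) ?_
  intro q hq
  simp only [Metric.mem_ball, dist_zero_right] at hq
  have := eulerProd_ne_zero hq
  have := eulerProd_pow_ne_zero hq (n := 6) (by norm_num)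
  positivity

lemma differentiableOn_vSer : DifferentiableOn ℂ vSer (Metric.ball 0 1) := by
  have h1 := differentiableOn_eulerProd
  have h2 := differentiableOn_eulerProd_pow (n := 2) (by norm_num)
  have h3 := differentiableOn_eulerProd_pow (n := 3) (by norm_num)
  have h6 := differentiableOn_eulerProd_pow (n := 6) (by norm_num)
  refine DifferentiableOn.div (by fun_prop) (by fun_prop) ?_
  intro q hq
  simp only [Metric.mem_ball, dist_zero_right] at hq
  have := eulerProd_ne_zero hq
  have := eulerProd_pow_ne_zero hq (n := 6) (by norm_num)
  positivity

lemma differentiableOn_gSer : DifferentiableOn ℂ gSer (Metric.ball 0 1) := by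
  have hu := differentiableOn_uSer
  refine DifferentiableOn.mul (DifferentiableOn.div (by fun_prop) (by fun_prop) ?_)
    differentiableOn_fSer
  intro q hq
  simp only [Metric.mem_ball, dist_zero_right] at hq
  exact mul_ne_zero (by norm_num) (pow_ne_zero _ (uSer_ne_zero hq))

lemma differentiableOn_kSer : DifferentiableOn ℂ kSer (Metric.ball 0 1) := by
  have hu := differentiableOn_vSer
  refine DifferentiableOn.mul (DifferentiableOn.div (by fun_prop) (by fun_prop) ?_)
    differentiableOn_fSer
  intro q hq
  simp only [Metric.mem_ball, dist_zero_right] at hq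
  exact mul_ne_zero (by norm_num) (pow_ne_zero _ (vSer_ne_zero hq))

lemma fSer_zero : fSer 0 = 1 := by
  simp [fSer, eulerProd_zero]

lemma vSer_zero : vSer 0 = 1 := by
  simp [vSer, eulerProd_zero]

lemma kSer_zero : kSer 0 = 1 / 8 := by
  simp [kSer, vSer_zero, fSer_zero]

lemma hasDerivAt_fSer_zero : HasDerivAt fSer (-2) 0 := by
  have h := (((hasDerivAt_eulerProd_zero.mul (hasDerivAt_eulerProd_pow_zero (n := 2) (by norm_num))).mul
    (hasDerivAt_eulerProd_pow_zero (n := 3) (by norm_num))).mul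
    (hasDerivAt_eulerProd_pow_zero (n := 6) (by norm_num))).pow 2
  refine h.congr_deriv ?_
  simp [eulerProd_zero]

lemma hasDerivAt_vSer_zero : HasDerivAt vSer 4 0 := by
  have h2 := hasDerivAt_eulerProd_pow_zero (n := 2) (by norm_num)
  have h3 := hasDerivAt_eulerProd_pow_zero (n := 3) (by norm_num)
  have h6 := hasDerivAt_eulerProd_pow_zero (n := 6) (by norm_num)
  have h := ((h2.pow 8).mul (h3.pow 4)).div ((h6.pow 8).mul (hasDerivAt_eulerProd_zero.pow 4))
    (by simp [eulerProd_zero])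
  refine h.congr_deriv ?_
  simp [eulerProd_zero]

lemma hasDerivAt_kSer_zero : HasDerivAt kSer 0 0 := by
  have hv := hasDerivAt_vSer_zero
  have h := (((((hv.sub ((hasDerivAt_id (0 : ℂ)).const_mul 3)).pow 2).mul
    ((hv.pow 2).add (((hasDerivAt_id (0 : ℂ)).pow 2).const_mul 9))).div
    ((hv.pow 2).const_mul 8) (by simp [vSer_zero]))).mul hasDerivAt_fSer_zero
  refine h.congr_deriv ?_
  simp [vSer_zero, fSer_zero]
  norm_num

lemma nome_ne_zero (z : ℂ) : nome z ≠ 0 := Complex.exp_ne_zero _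

lemma nome_nat_mul (n : ℕ) [n.AtLeastTwo] (z : ℂ) :
    nome ((OfNat.ofNat n : ℂ) * z) = nome z ^ n := by
  change nome (((n : ℕ) : ℂ) * z) = _
  unfold nome
  rw [← Complex.exp_nat_mul]
  congr 1
  ring

lemma norm_nome (z : ℂ) : ‖nome z‖ = Real.exp (-(2 * π * z.im)) := by
  unfold nome
  rw [Complex.norm_exp]
  congr 1
  simp

lemma norm_nome_lt_one {z : ℂ} (hz : 0 < z.im) : ‖nome z‖ < 1 := by
  rw [norm_nome, Real.exp_lt_one_iff]
  have := Real.pi_pos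
  have : 0 < 2 * π * z.im := by positivity
  linarith

lemma etaSq_nome (z : ℂ) :
    etaSq z = cexp (π * I * z / 6) * eulerProd (nome z) ^ 2 ∧
    etaSq (2 * z) = cexp (π * I * z / 6) ^ 2 * eulerProd (nome z ^ 2) ^ 2 ∧
    etaSq (3 * z) = cexp (π * I * z / 6) ^ 3 * eulerProd (nome z ^ 3) ^ 2 ∧
    etaSq (6 * z) = cexp (π * I * z / 6) ^ 6 * eulerProd (nome z ^ 6) ^ 2 := by
  refine ⟨etaSq_eq z, ?_, ?_, ?_⟩ <;>
  · rw [etaSq_eq, nome_nat_mul, ← Complex.exp_nat_mul]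
    congr 2
    push_cast
    ring

lemma exp_pow_twelve (z : ℂ) : cexp (π * I * z / 6) ^ 12 = nome z := by
  rw [← Complex.exp_nat_mul, nome]
  congr 1
  push_cast
  ring

lemma f46_eq_nome (z : ℂ) : f46 z = nome z * fSer (nome z) := by
  obtain ⟨h1, h2, h3, h6⟩ := etaSq_nome z
  rw [f46_eq, h1, h2, h3, h6, fSer]
  linear_combination (eulerProd (nome z) * eulerProd (nome z ^ 2) * eulerProd (nome z ^ 3) *
    eulerProd (nome z ^ 6)) ^ 2 * exp_pow_twelve z

lemma uInf_eq_nome (z : ℂ) : uInf z = uSer (nome z) := by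
  obtain ⟨h1, h2, h3, h6⟩ := etaSq_nome z
  have := Complex.exp_ne_zero (π * I * z / 6)
  rw [uInf, h1, h2, h3, h6, uSer]
  generalize cexp (π * I * z / 6) = x at *
  rw [show 9 * (x ^ 2 * eulerProd (nome z ^ 2) ^ 2) ^ 2 *
    (x ^ 3 * eulerProd (nome z ^ 3) ^ 2) ^ 4 =
    x ^ 16 * (9 * eulerProd (nome z ^ 2) ^ 4 * eulerProd (nome z ^ 3) ^ 8) by ring,
    show (x * eulerProd (nome z) ^ 2) ^ 4 * (x ^ 6 * eulerProd (nome z ^ 6) ^ 2) ^ 2 =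
    x ^ 16 * (eulerProd (nome z) ^ 8 * eulerProd (nome z ^ 6) ^ 4) by ring,
    mul_div_mul_left _ _ (pow_ne_zero _ this)]

lemma g46_eq_nome (z : ℂ) : g46 z = nome z * gSer (nome z) := by
  rw [g46_eq, uInf_eq_nome, f46_eq_nome, gSer]
  ring

lemma uZero_eq_nome (z : ℂ) : uZero z = vSer (nome z) / nome z := by
  obtain ⟨h1, h2, h3, h6⟩ := etaSq_nome z
  have h0 := Complex.exp_ne_zero (π * I * z / 6)
  have h12 := exp_pow_twelve z
  rw [uZero, h1, h2, h3, h6, vSer]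
  generalize cexp (π * I * z / 6) = x at *
  rw [show (x ^ 2 * eulerProd (nome z ^ 2) ^ 2) ^ 4 *
    (x ^ 3 * eulerProd (nome z ^ 3) ^ 2) ^ 2 =
    x ^ 14 * (eulerProd (nome z ^ 2) ^ 8 * eulerProd (nome z ^ 3) ^ 4) by ring,
    show (x ^ 6 * eulerProd (nome z ^ 6) ^ 2) ^ 4 * (x * eulerProd (nome z) ^ 2) ^ 2 =
    x ^ 14 * ((eulerProd (nome z ^ 6) ^ 8 * eulerProd (nome z) ^ 4) * x ^ 12) by ring,
    mul_div_mul_left _ _ (pow_ne_zero _ h0), h12, div_div]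

lemma k46_eq_nome {z : ℂ} (hz : 0 < z.im) : k46 z = kSer (nome z) / nome z := by
  rw [k46, uZero_eq_nome, f46_eq_nome, kSer, ratPhi]
  have := nome_ne_zero z
  have := vSer_ne_zero (norm_nome_lt_one hz)
  field_simp

lemma hasDerivAt_nome (z : ℂ) : HasDerivAt nome (2 * π * I * nome z) z := by
  have h : HasDerivAt (fun z : ℂ => 2 * π * I * z) (2 * π * I) z := by
    simpa using (hasDerivAt_id z).const_mul (2 * π * I)
  refine h.cexp.congr_deriv ?_
  rw [nome]
  ring

lemma exists_reduced {ψ : ℂ → ℂ} (hT : Function.Periodic ψ 1)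
    (hS : ∀ z : ℂ, 0 < z.im → ψ (-1 / (3 * z)) = ψ z) {z : ℂ} (hz : 0 < z.im) :
    ∃ w : ℂ, 1 / 4 ≤ w.im ∧ |w.re| ≤ 1 / 2 ∧ ψ w = ψ z := by
  have key : ∀ n : ℕ, ∀ z : ℂ, 0 < z.im → (15 / 16 : ℝ) ^ n * (1 / 4) ≤ z.im →
      ∃ w : ℂ, 1 / 4 ≤ w.im ∧ |w.re| ≤ 1 / 2 ∧ ψ w = ψ z := by
    intro n
    induction n with
    | zero =>
      intro z _ h
      refine ⟨z - (round z.re : ℤ), by simpa using h, ?_, ?_⟩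
      · simpa using abs_sub_round z.re
      · simpa using hT.sub_zsmul_eq (round z.re) (x := z)
    | succ n ih =>
      intro z hz h
      set w : ℂ := z - (round z.re : ℤ) with hw
      have hwim : w.im = z.im := by simp [hw]
      have hwre : |w.re| ≤ 1 / 2 := by simpa [hw] using abs_sub_round z.re
      have hwψ : ψ w = ψ z := by simpa using hT.sub_zsmul_eq (round z.re) (x := z)
      by_cases h4 : 1 / 4 ≤ w.im
      · exact ⟨w, h4, hwre, hwψ⟩
      · push Not at h4
        have hwpos : 0 < w.im := by rw [hwim]; exact hz
        have hns : 3 * Complex.normSq w ≤ 15 / 16 := by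
          rw [Complex.normSq_apply]
          have := abs_le.mp hwre
          nlinarith
        have hnspos : 0 < Complex.normSq w := Complex.normSq_pos.mpr (ne_zero_of_im_pos hwpos)
        have him : (-1 / (3 * w)).im = w.im / (3 * Complex.normSq w) := by
          rw [div_eq_mul_inv, neg_one_mul, Complex.neg_im, Complex.inv_im]
          simp
          field_simp
          try norm_num
        have hge : (15 / 16 : ℝ) ^ n * (1 / 4) ≤ (-1 / (3 * w)).im := by
          rw [him, le_div_iff₀ (by positivity)]
          calc (15 / 16 : ℝ) ^ n * (1 / 4) * (3 * Complex.normSq w)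
              ≤ (15 / 16 : ℝ) ^ n * (1 / 4) * (15 / 16) := by gcongr
            _ = (15 / 16 : ℝ) ^ (n + 1) * (1 / 4) := by ring
            _ ≤ _ := by rw [hwim]; exact h
        obtain ⟨v, hv1, hv2, hv3⟩ := ih _ (im_neg_one_div_three hwpos) hge
        exact ⟨v, hv1, hv2, by rw [hv3, hS w hwpos, hwψ]⟩
  obtain ⟨n, hn⟩ := exists_pow_lt_of_lt_one (show 0 < 4 * z.im by positivity)
    (show (15 / 16 : ℝ) < 1 by norm_num)
  exact key n z hz (by linarith)

lemma eq_zero_of_invariant {ψ : ℂ → ℂ} (hd : ∀ z : ℂ, 0 < z.im → DifferentiableAt ℂ ψ z)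
    (hT : Function.Periodic ψ 1) (hS : ∀ z : ℂ, 0 < z.im → ψ (-1 / (3 * z)) = ψ z)
    (hlim : ∀ ε : ℝ, 0 < ε → ∃ B : ℝ, ∀ z : ℂ, B ≤ z.im → ‖ψ z‖ < ε) {z : ℂ} (hz : 0 < z.im) :
    ψ z = 0 := by
  by_contra hne
  obtain ⟨B, hB⟩ := hlim ‖ψ z‖ (norm_pos_iff.mpr hne)
  set K : Set ℂ := Set.Icc (-(1 / 2)) (1 / 2) ×ℂ Set.Icc (1 / 4) B with hK
  have hKc : IsCompact K := isCompact_Icc.reProdIm isCompact_Icc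
  have hred : ∀ w : ℂ, 0 < w.im → ∃ v, 0 < v.im ∧ ψ v = ψ w ∧ (v ∈ K ∨ ‖ψ v‖ < ‖ψ z‖) := by
    intro w hw
    obtain ⟨v, h1, h2, h3⟩ := exists_reduced hT hS hw
    refine ⟨v, by linarith, h3, ?_⟩
    by_cases hvB : B ≤ v.im
    · exact Or.inr (hB v hvB)
    · left
      push Not at hvB
      rw [hK, Complex.mem_reProdIm]
      exact ⟨abs_le.mp h2, h1, hvB.le⟩
  have hcont : ContinuousOn (fun w => ‖ψ w‖) K := by
    intro w hw
    rw [hK, Complex.mem_reProdIm] at hw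
    exact ((hd w (by linarith [hw.2.1])).continuousAt.norm).continuousWithinAt
  obtain ⟨v, -, hv, hvK⟩ := hred z hz
  have hvK : v ∈ K := by
    rcases hvK with h | h
    · exact h
    · rw [hv] at h
      exact absurd h (lt_irrefl _)
  obtain ⟨c, hcK, hc⟩ := hKc.exists_isMaxOn ⟨v, hvK⟩ hcont
  have hzc : ‖ψ z‖ ≤ ‖ψ c‖ := by
    rw [← hv]
    exact hc hvK
  have hmax : ∀ w : ℂ, 0 < w.im → ‖ψ w‖ ≤ ‖ψ c‖ := by
    intro w hw
    obtain ⟨v, -, h2, h3⟩ := hred w hw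
    rw [← h2]
    rcases h3 with h | h
    · exact hc h
    · exact h.le.trans hzc
  have hcim : 0 < c.im := by
    rw [hK, Complex.mem_reProdIm] at hcK
    linarith [hcK.2.1]
  have hopen : IsOpen {w : ℂ | 0 < w.im} := isOpen_lt continuous_const Complex.continuous_im
  have hconst := Complex.eqOn_of_isPreconnected_of_isMaxOn_norm (f := ψ)
    (convex_halfSpace_im_gt 0).isPreconnected hopen
    (fun w hw => (hd w hw).differentiableWithinAt) hcim (fun w hw => hmax w hw)
  have hBpos : (0 : ℝ) < max B 1 := lt_max_of_lt_right one_pos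
  have h1 := hB (⟨0, max B 1⟩ : ℂ) (le_max_left _ _)
  have h2 := hconst (show (⟨0, max B 1⟩ : ℂ) ∈ {w : ℂ | 0 < w.im} from hBpos)
  rw [h2] at h1
  simp only [Function.const_apply] at h1
  linarith

/-- A function has exponential decay at `i∞` of order at least that of the nome. -/
def NomeBound (φ : ℂ → ℂ) : Prop :=
  ∃ C A : ℝ, 0 ≤ C ∧ ∀ z : ℂ, A ≤ z.im → ‖φ z‖ ≤ C * ‖nome z‖

lemma exists_norm_nome_lt {δ : ℝ} (hδ : 0 < δ) : ∃ B : ℝ, 0 < B ∧ ∀ z : ℂ, B ≤ z.im →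
    ‖nome z‖ < δ := by
  have ht : Tendsto (fun y : ℝ => Real.exp (-(2 * π * y))) atTop (𝓝 0) := by
    refine Real.tendsto_exp_neg_atTop_nhds_zero.comp ?_
    exact tendsto_id.const_mul_atTop (by positivity)
  obtain ⟨B, hB⟩ := eventually_atTop.mp (ht.eventually_lt_const hδ)
  refine ⟨max B 1, lt_max_of_lt_right one_pos, fun z hz => ?_⟩
  rw [norm_nome]
  exact hB _ ((le_max_left _ _).trans hz)

lemma nomeBound_of_series {φ Φ : ℂ → ℂ} (hΦ : ContinuousAt Φ 0)
    (h : ∀ z : ℂ, 0 < z.im → φ z = nome z * Φ (nome z)) : NomeBound φ := by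
  have h1 : ∀ᶠ q in 𝓝 (0 : ℂ), ‖Φ q‖ < ‖Φ 0‖ + 1 :=
    hΦ.norm.eventually_lt_const (by linarith)
  obtain ⟨δ, hδ, hb⟩ := Metric.eventually_nhds_iff.mp h1
  obtain ⟨B, hB0, hB⟩ := exists_norm_nome_lt hδ
  refine ⟨‖Φ 0‖ + 1, B, by positivity, fun z hz => ?_⟩
  rw [h z (by linarith), norm_mul, mul_comm]
  have := hb (y := nome z) (by simpa using hB z hz)
  gcongr

lemma NomeBound.add {φ χ : ℂ → ℂ} (h1 : NomeBound φ) (h2 : NomeBound χ) :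
    NomeBound (fun z => φ z + χ z) := by
  obtain ⟨C, A, hC, h⟩ := h1
  obtain ⟨C', A', hC', h'⟩ := h2
  refine ⟨C + C', max A A', by positivity, fun z hz => ?_⟩
  refine (norm_add_le _ _).trans ?_
  rw [add_mul]
  exact add_le_add (h z ((le_max_left _ _).trans hz)) (h' z ((le_max_right _ _).trans hz))

lemma NomeBound.const_mul {φ : ℂ → ℂ} (h1 : NomeBound φ) (c : ℂ) :
    NomeBound (fun z => c * φ z) := by
  obtain ⟨C, A, hC, h⟩ := h1
  refine ⟨‖c‖ * C, A, by positivity, fun z hz => ?_⟩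
  rw [norm_mul, mul_assoc]
  gcongr
  exact h z hz

lemma NomeBound.lim {φ : ℂ → ℂ} (h : NomeBound φ) {ε : ℝ} (hε : 0 < ε) :
    ∃ B : ℝ, ∀ z : ℂ, B ≤ z.im → ‖φ z‖ < ε := by
  obtain ⟨C, A, hC, h⟩ := h
  obtain ⟨B, hB0, hB⟩ := exists_norm_nome_lt (show 0 < ε / (C + 1) by positivity)
  refine ⟨max A B, fun z hz => (h z ((le_max_left _ _).trans hz)).trans_lt ?_⟩
  have h1 := hB z ((le_max_right _ _).trans hz)
  rw [lt_div_iff₀ (by positivity)] at h1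
  nlinarith [norm_nonneg (nome z)]

/-- A cusp form of weight four for the extended level-three group vanishes. -/
lemma eq_zero_of_weight_four {φ : ℂ → ℂ} (hd : ∀ z : ℂ, 0 < z.im → DifferentiableAt ℂ φ z)
    (hT : Function.Periodic φ 1)
    (hS : ∀ z : ℂ, 0 < z.im → φ (-1 / (3 * z)) = 9 * z ^ 4 * φ z) (hφ : NomeBound φ)
    {z : ℂ} (hz : 0 < z.im) : φ z = 0 := by
  set ψ : ℂ → ℂ := fun z => φ z ^ 3 / (etaSq z * etaSq (3 * z)) ^ 6 with hψ
  have hne : ∀ z : ℂ, 0 < z.im → (etaSq z * etaSq (3 * z)) ^ 6 ≠ 0 := fun z hz =>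
    pow_ne_zero _ (mul_ne_zero (etaSq_ne_zero hz) (etaSq_ne_zero (im_nat_mul 3 hz)))
  have h0 : ψ z = 0 := by
    refine eq_zero_of_invariant (ψ := ψ) ?_ ?_ ?_ ?_ hz
    · intro z hz
      refine DifferentiableAt.div ((hd z hz).pow 3) ?_ (hne z hz)
      refine DifferentiableAt.pow (DifferentiableAt.mul (differentiableAt_etaSq hz) ?_) 6
      exact (differentiableAt_etaSq (im_nat_mul 3 hz)).comp z (by fun_prop)
    · intro z
      have h1 : etaSq (z + 1) = zetaT * etaSq z := etaSq_add_one z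
      simp only [hψ]
      rw [hT z, h1, (etaSq_mul_add_one z).2.1]
      congr 1
      have : zetaT ^ 24 = 1 := by
        rw [show zetaT ^ 24 = (zetaT ^ 12) ^ 2 by ring, zetaT_pow_twelve, one_pow]
      linear_combination (etaSq z * etaSq (3 * z)) ^ 6 * this
    · intro z hz
      obtain ⟨h1, h2, -, -⟩ := etaSq_fricke_half hz
      simp only [hψ]
      rw [hS z hz, h1, h2]
      have hz0 := ne_zero_of_im_pos hz
      have e : (-I * (3 * z) * etaSq (3 * z) * (-I * z * etaSq z)) =
          (-3 * z ^ 2) * (etaSq z * etaSq (3 * z)) := by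
        linear_combination 3 * z ^ 2 * etaSq z * etaSq (3 * z) * Complex.I_sq
      rw [e, mul_pow (9 * z ^ 4), mul_pow (-3 * z ^ 2),
        show (9 * z ^ 4) ^ 3 = (-3 * z ^ 2) ^ 6 by ring, mul_div_mul_left]
      exact pow_ne_zero _ (mul_ne_zero (by norm_num) (pow_ne_zero _ hz0))
    · intro ε hε
      obtain ⟨C, A, hC, hb⟩ := hφ
      set Q : ℂ → ℂ := fun q => (eulerProd q * eulerProd (q ^ 3)) ^ 12 with hQ
      have hQc : ContinuousAt Q 0 := by
        have h3 := hasDerivAt_eulerProd_pow_zero (n := 3) (by norm_num)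
        exact (hasDerivAt_eulerProd_zero.continuousAt.mul h3.continuousAt).pow 12
      have hQ0 : ‖Q 0‖ = 1 := by simp [hQ, eulerProd_zero]
      have hev : ∀ᶠ q in 𝓝 (0 : ℂ), 1 / 2 < ‖Q q‖ :=
        hQc.norm.eventually_const_lt (by simp only [hQ0]; norm_num)
      obtain ⟨δ, hδ, hδb⟩ := Metric.eventually_nhds_iff.mp hev
      obtain ⟨B, hB0, hB⟩ := exists_norm_nome_lt hδ
      obtain ⟨B', hB0', hB'⟩ := exists_norm_nome_lt (show 0 < ε / (2 * (C ^ 3 + 1)) by positivity)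
      refine ⟨max A (max B B'), fun z hz => ?_⟩
      have hzA : A ≤ z.im := (le_max_left _ _).trans hz
      have hzB : B ≤ z.im := (le_max_left _ _).trans ((le_max_right _ _).trans hz)
      have hzB' : B' ≤ z.im := (le_max_right _ _).trans ((le_max_right _ _).trans hz)
      have hq := hδb (y := nome z) (by simpa using hB z hzB)
      have hden : (etaSq z * etaSq (3 * z)) ^ 6 = nome z ^ 2 * Q (nome z) := by
        obtain ⟨h1, -, h3, -⟩ := etaSq_nome z
        rw [h1, h3]
        simp only [hQ]
        linear_combination (cexp (π * I * z / 6) ^ 12 + nome z) *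
          (eulerProd (nome z) * eulerProd (nome z ^ 3)) ^ 12 * exp_pow_twelve z
      simp only [hψ]
      rw [hden, norm_div, norm_pow, norm_mul, norm_pow]
      have hn0 : 0 < ‖nome z‖ := norm_pos_iff.mpr (nome_ne_zero z)
      have h5 := hB' z hzB'
      rw [lt_div_iff₀ (by positivity)] at h5
      have hQpos : 0 < ‖Q (nome z)‖ := by linarith
      rw [div_lt_iff₀ (mul_pos (pow_pos hn0 2) hQpos)]
      calc ‖φ z‖ ^ 3 ≤ (C * ‖nome z‖) ^ 3 := 
          pow_le_pow_left₀ (norm_nonneg _) (hb z hzA) 3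
        _ = C ^ 3 * ‖nome z‖ * ‖nome z‖ ^ 2 := by ring
        _ < (ε / 2) * ‖nome z‖ ^ 2 := by
          refine mul_lt_mul_of_pos_right ?_ (by positivity)
          linarith
        _ = ε * (‖nome z‖ ^ 2 * (1 / 2)) := by ring
        _ ≤ _ := mul_le_mul_of_nonneg_left
          (mul_le_mul_of_nonneg_left hq.le (by positivity)) hε.le
  have h1 := hne z hz
  have h2 : φ z ^ 3 = 0 := by
    have h3 : φ z ^ 3 / (etaSq z * etaSq (3 * z)) ^ 6 = 0 := h0
    rwa [div_eq_zero_iff, or_iff_left h1] at h3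
  exact pow_eq_zero_iff (by norm_num) |>.mp h2

/-- `φ` is given on the upper half-plane by a power series in the nome, convergent in the unit
disc, with zero constant term and linear coefficient `a`. -/
def CuspSeries (φ : ℂ → ℂ) (a : ℂ) : Prop :=
  ∃ Φ : ℂ → ℂ, DifferentiableOn ℂ Φ (Metric.ball 0 1) ∧ Φ 0 = a ∧
    ∀ z : ℂ, 0 < z.im → φ z = nome z * Φ (nome z)

lemma ball_mem_nhds_zero : Metric.ball (0 : ℂ) 1 ∈ 𝓝 (0 : ℂ) :=
  Metric.ball_mem_nhds 0 one_pos

lemma eq_add_mul_dslope (Φ : ℂ → ℂ) (q : ℂ) : Φ q = Φ 0 + q * dslope Φ 0 q := by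
  have := sub_smul_dslope Φ 0 q
  rw [sub_zero, smul_eq_mul] at this
  rw [this]
  ring

lemma differentiableOn_dslope_zero {Φ : ℂ → ℂ} (h : DifferentiableOn ℂ Φ (Metric.ball 0 1)) :
    DifferentiableOn ℂ (dslope Φ 0) (Metric.ball 0 1) :=
  (Complex.differentiableOn_dslope ball_mem_nhds_zero).mpr h

lemma nome_mem_ball {z : ℂ} (hz : 0 < z.im) : nome z ∈ Metric.ball (0 : ℂ) 1 := by
  simpa using norm_nome_lt_one hz

lemma isOpen_im_pos : IsOpen {w : ℂ | 0 < w.im} :=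
  isOpen_lt continuous_const Complex.continuous_im

lemma eventually_im_pos {z : ℂ} (hz : 0 < z.im) : ∀ᶠ w in 𝓝 z, 0 < w.im :=
  isOpen_im_pos.mem_nhds hz

lemma nome_half (z : ℂ) : nome ((z + 1) / 2) = -nome (z / 2) := by
  unfold nome
  rw [show 2 * π * I * ((z + 1) / 2) = 2 * π * I * (z / 2) + π * I by ring, Complex.exp_add,
    Complex.exp_pi_mul_I]
  ring

namespace CuspSeries

variable {φ χ : ℂ → ℂ} {a b : ℂ}

lemma differentiableAt (h : CuspSeries φ a) {z : ℂ} (hz : 0 < z.im) :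
    DifferentiableAt ℂ φ z := by
  obtain ⟨Φ, hΦ, -, he⟩ := h
  have h1 : DifferentiableAt ℂ (fun w => nome w * Φ (nome w)) z := by
    have hn := (hasDerivAt_nome z).differentiableAt
    refine hn.mul (DifferentiableAt.comp z ?_ hn)
    exact hΦ.differentiableAt (Metric.isOpen_ball.mem_nhds (nome_mem_ball hz))
  refine h1.congr_of_eventuallyEq ?_
  filter_upwards [eventually_im_pos hz] with w hw using he w hw

lemma add_one (h : CuspSeries φ a) {z : ℂ} (hz : 0 < z.im) : φ (z + 1) = φ z := by
  obtain ⟨Φ, -, -, he⟩ := h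
  rw [he z hz, he (z + 1) (by simpa using hz), nome_add_one]

lemma nomeBound (h : CuspSeries φ a) : NomeBound φ := by
  obtain ⟨Φ, hΦ, -, he⟩ := h
  exact nomeBound_of_series (hΦ.differentiableAt ball_mem_nhds_zero).continuousAt he

lemma mul (h1 : CuspSeries φ a) (h2 : CuspSeries χ b) : CuspSeries (fun z => φ z * χ z) 0 := by
  obtain ⟨Φ, hΦ, -, he⟩ := h1
  obtain ⟨Χ, hΧ, -, he'⟩ := h2
  refine ⟨fun q => q * Φ q * Χ q, by fun_prop, by simp, fun z hz => ?_⟩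
  simp only [he z hz, he' z hz]
  ring

lemma add (h1 : CuspSeries φ a) (h2 : CuspSeries χ b) :
    CuspSeries (fun z => φ z + χ z) (a + b) := by
  obtain ⟨Φ, hΦ, rfl, he⟩ := h1
  obtain ⟨Χ, hΧ, rfl, he'⟩ := h2
  refine ⟨fun q => Φ q + Χ q, by fun_prop, rfl, fun z hz => ?_⟩
  simp only [he z hz, he' z hz]
  ring

lemma exists_primitive (h : CuspSeries φ a) :
    ∃ ψ : ℂ → ℂ, CuspSeries ψ (a / (2 * π * I)) ∧ ∀ z : ℂ, 0 < z.im → HasDerivAt ψ (φ z) z := by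
  obtain ⟨Φ, hΦ, rfl, he⟩ := h
  have h2 : (2 * π * I : ℂ) ≠ 0 := Complex.two_pi_I_ne_zero
  have hΦ' : DifferentiableOn ℂ (fun q => Φ q / (2 * π * I)) (Metric.ball 0 1) :=
    hΦ.div_const _
  obtain ⟨H, hH0, hH⟩ := hΦ'.isExactOn_ball.with_val_at 0 0
  have hHd : DifferentiableOn ℂ H (Metric.ball 0 1) := fun q hq =>
    (hH q hq).differentiableAt.differentiableWithinAt
  have hHeq : ∀ q, H q = q * dslope H 0 q := by
    intro q
    conv_lhs => rw [eq_add_mul_dslope H q, hH0, zero_add]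
  refine ⟨fun z => H (nome z), ⟨dslope H 0, differentiableOn_dslope_zero hHd, ?_,
    fun z hz => hHeq _⟩, fun z hz => ?_⟩
  · rw [dslope_same]
    exact (hH 0 (by simp)).deriv
  · have := (hH _ (nome_mem_ball hz)).comp z (hasDerivAt_nome z)
    refine this.congr_deriv ?_
    rw [he z hz]
    field_simp

lemma half_sum (h : CuspSeries φ a) : NomeBound (fun z => φ (z / 2) + φ ((z + 1) / 2)) := by
  obtain ⟨Φ, hΦ, -, he⟩ := h
  have hc : ContinuousAt (fun p => dslope Φ 0 p + dslope Φ 0 (-p)) 0 := by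
    have h1 : ContinuousAt (dslope Φ 0) 0 :=
      ((differentiableOn_dslope_zero hΦ).differentiableAt ball_mem_nhds_zero).continuousAt
    refine h1.add (ContinuousAt.comp (g := dslope Φ 0) ?_ continuousAt_neg)
    rw [neg_zero]
    exact h1
  have h1 : ∀ᶠ q in 𝓝 (0 : ℂ), ‖dslope Φ 0 q + dslope Φ 0 (-q)‖ <
      ‖dslope Φ 0 0 + dslope Φ 0 (-0)‖ + 1 :=
    hc.norm.eventually_lt_const (by simp only; linarith)
  obtain ⟨δ, hδ, hb⟩ := Metric.eventually_nhds_iff.mp h1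
  obtain ⟨B, hB0, hB⟩ := exists_norm_nome_lt hδ
  refine ⟨‖dslope Φ 0 0 + dslope Φ 0 (-0)‖ + 1, 2 * B, by positivity, fun z hz => ?_⟩
  have hz0 : 0 < z.im := by linarith
  have hsq : nome z = nome (z / 2) ^ 2 := by
    rw [← nome_nat_mul]
    congr 1
    ring
  have hzim : B ≤ (z / 2).im := by
    have : (z / 2).im = z.im / 2 := by simp
    rw [this]; linarith
  have hlt := hb (y := nome (z / 2)) (by simpa using hB _ hzim)
  have : φ (z / 2) + φ ((z + 1) / 2) =
      nome z * (dslope Φ 0 (nome (z / 2)) + dslope Φ 0 (-nome (z / 2))) := by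
    rw [he _ (im_half' hz0), he _ (im_half hz0), nome_half, hsq]
    rw [eq_add_mul_dslope Φ (nome (z / 2)), eq_add_mul_dslope Φ (-nome (z / 2))]
    ring
  simp only [this]
  rw [norm_mul, mul_comm]
  exact mul_le_mul_of_nonneg_right hlt.le (norm_nonneg _)

end CuspSeries

lemma cuspSeries_f46 : CuspSeries f46 1 :=
  ⟨fSer, differentiableOn_fSer, fSer_zero, fun z _ => f46_eq_nome z⟩

lemma cuspSeries_g46 : CuspSeries g46 (gSer 0) :=
  ⟨gSer, differentiableOn_gSer, rfl, fun z _ => g46_eq_nome z⟩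

/-- The regular part of `k46` at `i∞`. -/
noncomputable def k46Reg (z : ℂ) : ℂ := nome z * dslope (dslope kSer 0) 0 (nome z)

lemma cuspSeries_k46Reg : CuspSeries k46Reg (dslope (dslope kSer 0) 0 0) :=
  ⟨_, differentiableOn_dslope_zero (differentiableOn_dslope_zero differentiableOn_kSer), rfl,
    fun _ _ => rfl⟩

lemma k46_eq_add_reg {z : ℂ} (hz : 0 < z.im) : k46 z = 1 / 8 * (nome z)⁻¹ + k46Reg z := by
  have h1 : dslope kSer 0 0 = 0 := by
    rw [dslope_same]
    exact hasDerivAt_kSer_zero.deriv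
  have h2 := eq_add_mul_dslope (dslope kSer 0) (nome z)
  rw [h1, zero_add] at h2
  rw [k46_eq_nome hz, eq_add_mul_dslope kSer (nome z), h2, kSer_zero, k46Reg]
  have := nome_ne_zero z
  field_simp

lemma differentiableAt_k46 {z : ℂ} (hz : 0 < z.im) : DifferentiableAt ℂ k46 z := by
  have h1 : DifferentiableAt ℂ (fun z => 1 / 8 * (nome z)⁻¹ + k46Reg z) z :=
    (((hasDerivAt_nome z).differentiableAt.inv (nome_ne_zero z)).const_mul _).add
      (cuspSeries_k46Reg.differentiableAt hz)
  refine h1.congr_of_eventuallyEq ?_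
  filter_upwards [eventually_im_pos hz] with w hw using k46_eq_add_reg hw

lemma fricke_half_args {z : ℂ} (hz : 0 < z.im) :
    -1 / (3 * z) = -1 / (6 * (z / 2)) ∧ -1 / (3 * z) / 2 = -1 / (6 * z) := by
  have := ne_zero_of_im_pos hz
  constructor <;> field_simp <;> norm_num

/-- The level-three trace of a compatible pair of level-six forms vanishes. -/
lemma trace_eq_zero {a b : ℂ → ℂ} (ha : ∀ z : ℂ, 0 < z.im → DifferentiableAt ℂ a z)
    (hb : ∀ z : ℂ, 0 < z.im → DifferentiableAt ℂ b z)
    (haT : Function.Periodic a 1) (hbT : Function.Periodic b 1)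
    (hab : ∀ z : ℂ, 0 < z.im → a (-1 / (6 * z)) = 36 * z ^ 4 * b z)
    (hba : ∀ z : ℂ, 0 < z.im → b (-1 / (6 * z)) = 36 * z ^ 4 * a z)
    (hbb : ∀ z : ℂ, 0 < z.im → b ((-1 / (3 * z) + 1) / 2) = 9 * z ^ 4 * b ((z + 1) / 2))
    (hbound : NomeBound (fun z => 4 * a z + (b (z / 2) + b ((z + 1) / 2))))
    {z : ℂ} (hz : 0 < z.im) : 4 * a z + (b (z / 2) + b ((z + 1) / 2)) = 0 := by
  refine eq_zero_of_weight_four (φ := fun z => 4 * a z + (b (z / 2) + b ((z + 1) / 2)))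
    ?_ ?_ ?_ hbound hz
  · intro z hz
    refine ((ha z hz).const_mul 4).add (DifferentiableAt.add ?_ ?_)
    · exact (hb _ (im_half' hz)).comp z (by fun_prop)
    · exact (hb _ (im_half hz)).comp z (by fun_prop)
  · intro z
    have e : (z + 1 + 1) / 2 = z / 2 + 1 := by ring
    simp only [haT z, e, hbT (z / 2)]
    ring
  · intro z hz
    obtain ⟨e1, e2⟩ := fricke_half_args hz
    simp only [hbb z hz]
    rw [e2, hba z hz, e1, hab _ (im_half' hz)]
    ring

lemma f46_trace {z : ℂ} (hz : 0 < z.im) : 4 * f46 z + (f46 (z / 2) + f46 ((z + 1) / 2)) = 0 := by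
  have hd := fun (z : ℂ) (hz : 0 < z.im) => cuspSeries_f46.differentiableAt hz
  exact trace_eq_zero hd hd f46_add_one f46_add_one (fun z hz => f46_fricke hz)
    (fun z hz => f46_fricke hz) (fun z hz => f46_half_fricke hz)
    ((cuspSeries_f46.nomeBound.const_mul 4).add cuspSeries_f46.half_sum) hz

lemma NomeBound.congr {φ χ : ℂ → ℂ} (h : NomeBound φ) (he : ∀ z : ℂ, 0 < z.im → χ z = φ z) :
    NomeBound χ := by
  obtain ⟨C, A, hC, h⟩ := h
  refine ⟨C, max A 1, hC, fun z hz => ?_⟩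
  rw [he z (lt_of_lt_of_le (lt_max_of_lt_right one_pos) hz)]
  exact h z ((le_max_left _ _).trans hz)

lemma k46_half_sum {z : ℂ} (hz : 0 < z.im) :
    k46 (z / 2) + k46 ((z + 1) / 2) = k46Reg (z / 2) + k46Reg ((z + 1) / 2) := by
  rw [k46_eq_add_reg (im_half hz), k46_eq_add_reg (im_half' hz), nome_half, inv_neg]
  ring

lemma gk46_trace {z : ℂ} (hz : 0 < z.im) : 4 * g46 z + (k46 (z / 2) + k46 ((z + 1) / 2)) = 0 := by
  refine trace_eq_zero (fun z hz => cuspSeries_g46.differentiableAt hz)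
    (fun z hz => differentiableAt_k46 hz) g46_add_one k46_add_one (fun z hz => g46_fricke hz)
    (fun z hz => k46_fricke hz) (fun z hz => k46_half_fricke hz) ?_ hz
  refine ((cuspSeries_g46.nomeBound.const_mul 4).add cuspSeries_k46Reg.half_sum).congr ?_
  intro z hz
  rw [k46_half_sum hz]

lemma const_of_deriv_zero {ψ : ℂ → ℂ} (h : ∀ z : ℂ, 0 < z.im → HasDerivAt ψ 0 z) {z w : ℂ}
    (hz : 0 < z.im) (hw : 0 < w.im) : ψ z = ψ w := by
  refine isOpen_im_pos.is_const_of_deriv_eq_zero (convex_halfSpace_im_gt 0).isPreconnected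
    (fun x hx => (h x hx).differentiableAt.differentiableWithinAt)
    (fun x hx => (h x hx).deriv) hz hw

lemma NomeBound.eq_zero {ψ : ℂ → ℂ} (hb : NomeBound ψ)
    (h : ∀ z : ℂ, 0 < z.im → HasDerivAt ψ 0 z) {z : ℂ} (hz : 0 < z.im) : ψ z = 0 := by
  by_contra hne
  obtain ⟨B, hB⟩ := hb.lim (norm_pos_iff.mpr hne)
  have hw : (0 : ℝ) < max B 1 := lt_max_of_lt_right one_pos
  have h1 := hB (⟨0, max B 1⟩ : ℂ) (le_max_left _ _)
  rw [const_of_deriv_zero h (w := z) hw hz] at h1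
  exact lt_irrefl _ h1

/-- `x 0, …, x 3` are successive derivatives on the upper half-plane. -/
structure IsJet (x : ℕ → ℂ → ℂ) : Prop where
  deriv_zero : ∀ z : ℂ, 0 < z.im → HasDerivAt (x 0) (x 1 z) z
  deriv_one : ∀ z : ℂ, 0 < z.im → HasDerivAt (x 1) (x 2 z) z
  deriv_two : ∀ z : ℂ, 0 < z.im → HasDerivAt (x 2) (x 3 z) z

/-- The weight `-2` action of `z ↦ -1/(3z)` together with its derivatives. -/
noncomputable def slash (x : ℕ → ℂ → ℂ) : ℕ → ℂ → ℂ
  | 0 => fun z => 3 * z ^ 2 * x 0 (-1 / (3 * z))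
  | 1 => fun z => 6 * z * x 0 (-1 / (3 * z)) + x 1 (-1 / (3 * z))
  | 2 => fun z => 6 * x 0 (-1 / (3 * z)) + 2 * z⁻¹ * x 1 (-1 / (3 * z)) +
      z⁻¹ ^ 2 / 3 * x 2 (-1 / (3 * z))
  | _ => fun z => z⁻¹ ^ 4 / 9 * x 3 (-1 / (3 * z))

/-- The bilinear form `x''y - x'y' + xy''`. -/
noncomputable def jetPair (x y : ℕ → ℂ → ℂ) (z : ℂ) : ℂ :=
  x 2 z * y 0 z - x 1 z * y 1 z + x 0 z * y 2 z

lemma hasDerivAt_neg_one_div_three {z : ℂ} (hz : 0 < z.im) :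
    HasDerivAt (fun z : ℂ => -1 / (3 * z)) (z⁻¹ ^ 2 / 3) z := by
  have h0 := ne_zero_of_im_pos hz
  have h := (hasDerivAt_inv h0).const_mul (-1 / 3 : ℂ)
  have e : (fun z : ℂ => -1 / (3 * z)) = fun z => -1 / 3 * z⁻¹ := by
    ext w
    ring
  rw [e]
  refine h.congr_deriv ?_
  field_simp

lemma HasDerivAt.comp_fricke {f : ℂ → ℂ} {f' z : ℂ} (hz : 0 < z.im)
    (hf : HasDerivAt f f' (-1 / (3 * z))) :
    HasDerivAt (fun w : ℂ => f (-1 / (3 * w))) (f' * (z⁻¹ ^ 2 / 3)) z :=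
  HasDerivAt.comp z hf (hasDerivAt_neg_one_div_three hz)

namespace IsJet

variable {x y : ℕ → ℂ → ℂ}

lemma slash (hx : IsJet x) : IsJet (slash x) where
  deriv_zero z hz := by
    have h0 := ne_zero_of_im_pos hz
    have hw := im_neg_one_div_three hz
    have h := ((hasDerivAt_pow 2 z).const_mul 3).mul ((hx.deriv_zero _ hw).comp_fricke hz)
    refine h.congr_deriv ?_
    simp only [_root_.slash]
    field_simp
    ring
  deriv_one z hz := by
    have h0 := ne_zero_of_im_pos hz
    have hw := im_neg_one_div_three hz
    have h := (((hasDerivAt_id z).const_mul 6).mul ((hx.deriv_zero _ hw).comp_fricke hz)).add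
      ((hx.deriv_one _ hw).comp_fricke hz)
    refine h.congr_deriv ?_
    simp only [_root_.slash, id]
    field_simp
    ring
  deriv_two z hz := by
    have h0 := ne_zero_of_im_pos hz
    have hw := im_neg_one_div_three hz
    have hi := hasDerivAt_inv h0
    have h := ((((hx.deriv_zero _ hw).comp_fricke hz).const_mul 6).add
      ((hi.const_mul 2).mul ((hx.deriv_one _ hw).comp_fricke hz))).add
      (((hi.pow 2).div_const 3).mul ((hx.deriv_two _ hw).comp_fricke hz))
    refine h.congr_deriv ?_
    simp only [_root_.slash, Pi.pow_apply]
    have e : z⁻¹ ^ (2 - 1) = z⁻¹ := pow_one _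
    push_cast
    rw [e]
    ring

lemma hasDerivAt_jetPair (hx : IsJet x) (hy : IsJet y) {z : ℂ} (hz : 0 < z.im) :
    HasDerivAt (jetPair x y) (x 3 z * y 0 z + x 0 z * y 3 z) z := by
  have h := (((hx.deriv_two z hz).mul (hy.deriv_zero z hz)).sub
    ((hx.deriv_one z hz).mul (hy.deriv_one z hz))).add
    ((hx.deriv_zero z hz).mul (hy.deriv_two z hz))
  refine h.congr_deriv ?_
  ring

lemma sub (hx : IsJet x) (hy : IsJet y) : IsJet (fun j z => x j z - y j z) where
  deriv_zero z hz := (hx.deriv_zero z hz).sub (hy.deriv_zero z hz)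
  deriv_one z hz := (hx.deriv_one z hz).sub (hy.deriv_one z hz)
  deriv_two z hz := (hx.deriv_two z hz).sub (hy.deriv_two z hz)

/-- A jet with vanishing third derivative is a quadratic polynomial. -/
lemma taylor (hx : IsJet x) (h3 : ∀ z : ℂ, 0 < z.im → x 3 z = 0) {z w : ℂ}
    (hz : 0 < z.im) (hw : 0 < w.im) :
    x 2 w = x 2 z ∧ x 1 w = x 1 z + x 2 z * (w - z) ∧
      x 0 w = x 0 z + x 1 z * (w - z) + x 2 z * (w - z) ^ 2 / 2 := by
  have e2 : ∀ v : ℂ, 0 < v.im → x 2 v = x 2 z := fun v hv =>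
    const_of_deriv_zero (fun v hv => by
      have := hx.deriv_two v hv
      rwa [h3 v hv] at this) hv hz
  have hlin : ∀ v : ℂ, HasDerivAt (fun v : ℂ => x 2 z * (v - z)) (x 2 z) v := fun v => by
    simpa using ((hasDerivAt_id v).sub_const z).const_mul (x 2 z)
  have e1 : ∀ v : ℂ, 0 < v.im → x 1 v = x 1 z + x 2 z * (v - z) := by
    intro v hv
    have := const_of_deriv_zero (ψ := fun v => x 1 v - x 2 z * (v - z)) (fun v hv => by
      refine ((hx.deriv_one v hv).sub (hlin v)).congr_deriv ?_
      rw [e2 v hv, sub_self]) hv hz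
    simp only [sub_self, mul_zero, sub_zero] at this
    linear_combination this
  refine ⟨e2 w hw, e1 w hw, ?_⟩
  have hquad : ∀ v : ℂ, HasDerivAt (fun v : ℂ => x 1 z * (v - z) + x 2 z * (v - z) ^ 2 / 2)
      (x 1 z + x 2 z * (v - z)) v := fun v => by
    have hs := (hasDerivAt_id v).sub_const z
    have := (hs.const_mul (x 1 z)).add (((hs.pow 2).const_mul (x 2 z)).div_const 2)
    refine this.congr_deriv ?_
    simp only [id]
    ring
  have := const_of_deriv_zero
    (ψ := fun v => x 0 v - (x 1 z * (v - z) + x 2 z * (v - z) ^ 2 / 2)) (fun v hv => by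
      refine ((hx.deriv_zero v hv).sub (hquad v)).congr_deriv ?_
      rw [e1 v hv, sub_self]) hw hz
  simp only [sub_self, mul_zero] at this
  linear_combination this

end IsJet

/-- The three conjugate iterated integrals attached to a pair of level-six forms. -/
structure EichlerTriple (X : Fin 3 → ℕ → ℂ → ℂ) : Prop where
  jet : ∀ i, IsJet (X i)
  add_one_zero : ∀ j < 3, ∀ z : ℂ, 0 < z.im → X 0 j (z + 1) = X 0 j z
  add_one_one : ∀ j < 3, ∀ z : ℂ, 0 < z.im → X 1 j (z + 1) = X 2 j z
  add_one_two : ∀ j < 3, ∀ z : ℂ, 0 < z.im → X 2 j (z + 1) = X 1 j z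
  sum_eq_zero : ∀ j < 3, ∀ z : ℂ, 0 < z.im → X 0 j z + X 1 j z + X 2 j z = 0
  fricke_zero : ∀ z : ℂ, 0 < z.im → X 0 3 (-1 / (3 * z)) = 9 * z ^ 4 * X 1 3 z
  fricke_one : ∀ z : ℂ, 0 < z.im → X 1 3 (-1 / (3 * z)) = 9 * z ^ 4 * X 0 3 z
  fricke_two : ∀ z : ℂ, 0 < z.im → X 2 3 (-1 / (3 * z)) = 9 * z ^ 4 * X 2 3 z

/-- The elliptic point fixed by `z ↦ 1 - 1/(3z)`. -/
noncomputable def ellipticPt : ℂ := (1 + I * ((1 / Real.sqrt 3 : ℝ) : ℂ)) / 2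

lemma ellipticPt_im : 0 < ellipticPt.im := by
  have : ellipticPt.im = (1 / Real.sqrt 3) / 2 := by
    unfold ellipticPt
    rw [show (1 + I * ((1 / Real.sqrt 3 : ℝ) : ℂ)) / 2 =
      ((1 / 2 : ℝ) : ℂ) + (((1 / Real.sqrt 3) / 2 : ℝ) : ℂ) * I by push_cast; ring]
    simp [-one_div]
  rw [this]
  positivity

lemma sqrt_three_sq_complex : ((1 / Real.sqrt 3 : ℝ) : ℂ) ^ 2 = 1 / 3 := by
  rw [← Complex.ofReal_pow, div_pow, Real.sq_sqrt (by norm_num)]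
  push_cast
  norm_num

lemma ellipticPt_sq : ellipticPt ^ 2 = ellipticPt - 1 / 3 := by
  unfold ellipticPt
  linear_combination (1 / 4) * I ^ 2 * sqrt_three_sq_complex + (1 / 12) * I_sq

lemma ellipticPt_sub_one_im : 0 < (ellipticPt - 1).im := by
  simpa using ellipticPt_im

lemma ellipticPt_inv : ellipticPt⁻¹ = 3 - 3 * ellipticPt := by
  rw [inv_eq_iff_eq_inv]
  refine eq_inv_of_mul_eq_one_left ?_
  linear_combination (-3) * ellipticPt_sq

lemma ellipticPt_sub_one_inv : (ellipticPt - 1)⁻¹ = -3 * ellipticPt := by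
  rw [inv_eq_iff_eq_inv]
  refine eq_inv_of_mul_eq_one_left ?_
  linear_combination (-3) * ellipticPt_sq

lemma fricke_ellipticPt : -1 / (3 * ellipticPt) = ellipticPt - 1 := by
  rw [show -1 / (3 * ellipticPt) = -1 / 3 * ellipticPt⁻¹ by ring, ellipticPt_inv]
  ring

lemma fricke_ellipticPt_sub_one : -1 / (3 * (ellipticPt - 1)) = ellipticPt := by
  rw [div_mul_eq_div_div, div_eq_mul_inv, ellipticPt_sub_one_inv]
  ring

namespace EichlerTriple

variable {X Y : Fin 3 → ℕ → ℂ → ℂ}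

lemma slash_third (hX : EichlerTriple X) {z : ℂ} (hz : 0 < z.im) :
    slash (X 0) 3 z = X 1 3 z ∧ slash (X 1) 3 z = X 0 3 z ∧ slash (X 2) 3 z = X 2 3 z := by
  have h0 := ne_zero_of_im_pos hz
  simp only [slash, hX.fricke_zero z hz, hX.fricke_one z hz, hX.fricke_two z hz]
  refine ⟨?_, ?_, ?_⟩ <;> field_simp

lemma _root_.slash_ellipticPt (x : ℕ → ℂ → ℂ) :
    slash x 0 ellipticPt = (3 * ellipticPt - 1) * x 0 (ellipticPt - 1) ∧
    slash x 1 ellipticPt = 6 * ellipticPt * x 0 (ellipticPt - 1) + x 1 (ellipticPt - 1) ∧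
    slash x 2 ellipticPt = 6 * x 0 (ellipticPt - 1) + (6 - 6 * ellipticPt) * x 1 (ellipticPt - 1) +
      (2 - 3 * ellipticPt) * x 2 (ellipticPt - 1) := by
  simp only [slash, fricke_ellipticPt, ellipticPt_inv]
  refine ⟨?_, trivial, ?_⟩
  · linear_combination 3 * x 0 (ellipticPt - 1) * ellipticPt_sq
  · linear_combination 3 * x 2 (ellipticPt - 1) * ellipticPt_sq

/-- The jet of the second member at the elliptic point is determined by that of the first. -/
lemma jet_ellipticPt (hX : EichlerTriple X) :
    2 * X 1 2 ellipticPt = 6 * X 0 1 ellipticPt + (2 - 6 * ellipticPt) * X 0 2 ellipticPt ∧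
    2 * X 1 1 ellipticPt = (6 * ellipticPt - 4) * X 0 1 ellipticPt - X 0 2 ellipticPt ∧
    2 * X 1 0 ellipticPt = -X 0 0 ellipticPt - 3 / 2 * X 0 1 ellipticPt := by
  have hz := ellipticPt_im
  have hw := ellipticPt_sub_one_im
  have hp := ((hX.jet 0).slash.sub (hX.jet 1)).taylor (fun z hz => by
    simp only [(hX.slash_third hz).1, sub_self]) hz hw
  obtain ⟨s0, s1, s2⟩ := slash_ellipticPt (X 0)
  simp only [s0, s1, s2] at hp
  simp only [slash, fricke_ellipticPt_sub_one, ellipticPt_sub_one_inv] at hp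
  have hT : ∀ j < 3, X 0 j (ellipticPt - 1) = X 0 j ellipticPt := fun j hj => by
    rw [← hX.add_one_zero j hj _ hw, sub_add_cancel]
  have hT1 : ∀ j < 3, X 1 j (ellipticPt - 1) = -X 0 j ellipticPt - X 1 j ellipticPt :=
    fun j hj => by
      rw [← hX.add_one_two j hj _ hw, sub_add_cancel]
      linear_combination hX.sum_eq_zero j hj _ hz
  rw [hT 0 (by norm_num), hT 1 (by norm_num), hT 2 (by norm_num), hT1 0 (by norm_num),
    hT1 1 (by norm_num), hT1 2 (by norm_num)] at hp
  obtain ⟨h2, h1, h0⟩ := hp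
  have e2 : 2 * X 1 2 ellipticPt =
      6 * X 0 1 ellipticPt + (2 - 6 * ellipticPt) * X 0 2 ellipticPt := by
    linear_combination h2 - 3 * X 0 2 ellipticPt * ellipticPt_sq
  have e1 : 2 * X 1 1 ellipticPt =
      (6 * ellipticPt - 4) * X 0 1 ellipticPt - X 0 2 ellipticPt := by
    linear_combination h1 + e2 / 2
  refine ⟨e2, e1, ?_⟩
  linear_combination h0 + e1 / 2 - e2 / 4 - 3 * X 0 0 ellipticPt * ellipticPt_sq

end EichlerTriple

/-- The fixed point `i/√3` of `z ↦ -1/(3z)`. -/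
noncomputable def frickePt : ℂ := I * ((1 / Real.sqrt 3 : ℝ) : ℂ)

lemma frickePt_im : 0 < frickePt.im := by
  have : frickePt.im = 1 / Real.sqrt 3 := by
    simp [frickePt, -one_div]
  rw [this]
  positivity

lemma frickePt_sq : frickePt ^ 2 = -1 / 3 := by
  unfold frickePt
  linear_combination I ^ 2 * sqrt_three_sq_complex + (1 / 3) * I_sq

lemma frickePt_inv : frickePt⁻¹ = -3 * frickePt := by
  rw [inv_eq_iff_eq_inv]
  refine eq_inv_of_mul_eq_one_left ?_
  linear_combination (-3) * frickePt_sq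

lemma fricke_frickePt : -1 / (3 * frickePt) = frickePt := by
  rw [div_mul_eq_div_div, div_eq_mul_inv, frickePt_inv]
  ring

lemma slash_frickePt (x : ℕ → ℂ → ℂ) :
    slash x 0 frickePt = -x 0 frickePt ∧
    slash x 1 frickePt = 6 * frickePt * x 0 frickePt + x 1 frickePt ∧
    slash x 2 frickePt = 6 * x 0 frickePt - 6 * frickePt * x 1 frickePt - x 2 frickePt := by
  simp only [slash, fricke_frickePt, frickePt_inv]
  refine ⟨?_, trivial, ?_⟩
  · linear_combination 3 * x 0 frickePt * frickePt_sq
  · linear_combination 3 * x 2 frickePt * frickePt_sq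

lemma jetPair_slash_frickePt (x y : ℕ → ℂ → ℂ) :
    jetPair x (slash y) frickePt = jetPair (slash x) y frickePt := by
  obtain ⟨h0, h1, h2⟩ := slash_frickePt x
  obtain ⟨k0, k1, k2⟩ := slash_frickePt y
  simp only [jetPair, h0, h1, h2, k0, k1, k2]
  ring

namespace EichlerTriple

variable {X Y : Fin 3 → ℕ → ℂ → ℂ}

/-- The period of a primitive of `∑ Xᵢ''' Yᵢ` in terms of the jets at the elliptic point. -/
lemma period_eq (hX : EichlerTriple X) (hY : EichlerTriple Y) {Ω : ℂ → ℂ} {r : ℂ}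
    (hΩ : ∀ z : ℂ, 0 < z.im →
      HasDerivAt Ω (X 0 3 z * Y 0 0 z + X 1 3 z * Y 1 0 z + X 2 3 z * Y 2 0 z) z)
    (hΩT : ∀ z : ℂ, 0 < z.im → Ω (z + 1) = Ω z + r) :
    r = 3 * (Y 0 2 ellipticPt * X 0 1 ellipticPt - Y 0 1 ellipticPt * X 0 2 ellipticPt) := by
  set L : ℂ → ℂ := fun z => 2 * Ω z -
    (jetPair (X 0) (Y 0) z + jetPair (X 1) (Y 1) z + jetPair (X 2) (Y 2) z) with hL
  have hLd : ∀ z : ℂ, 0 < z.im → HasDerivAt L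
      ((X 0 3 z * Y 0 0 z + X 1 3 z * Y 1 0 z + X 2 3 z * Y 2 0 z) -
        (X 0 0 z * Y 0 3 z + X 1 0 z * Y 1 3 z + X 2 0 z * Y 2 3 z)) z := by
    intro z hz
    have h := ((hΩ z hz).const_mul 2).sub
      ((((hX.jet 0).hasDerivAt_jetPair (hY.jet 0) hz).add
        ((hX.jet 1).hasDerivAt_jetPair (hY.jet 1) hz)).add
        ((hX.jet 2).hasDerivAt_jetPair (hY.jet 2) hz))
    refine h.congr_deriv ?_
    ring
  have hLT : ∀ z : ℂ, 0 < z.im → L (z + 1) = L z + 2 * r := by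
    intro z hz
    simp only [hL, jetPair, hΩT z hz, hX.add_one_zero 0 (by norm_num) z hz,
      hX.add_one_zero 1 (by norm_num) z hz, hX.add_one_zero 2 (by norm_num) z hz,
      hX.add_one_one 0 (by norm_num) z hz, hX.add_one_one 1 (by norm_num) z hz,
      hX.add_one_one 2 (by norm_num) z hz, hX.add_one_two 0 (by norm_num) z hz,
      hX.add_one_two 1 (by norm_num) z hz, hX.add_one_two 2 (by norm_num) z hz,
      hY.add_one_zero 0 (by norm_num) z hz,
      hY.add_one_zero 1 (by norm_num) z hz, hY.add_one_zero 2 (by norm_num) z hz,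
      hY.add_one_one 0 (by norm_num) z hz, hY.add_one_one 1 (by norm_num) z hz,
      hY.add_one_one 2 (by norm_num) z hz, hY.add_one_two 0 (by norm_num) z hz,
      hY.add_one_two 1 (by norm_num) z hz, hY.add_one_two 2 (by norm_num) z hz]
    ring
  set R : ℂ → ℂ := fun z =>
    ((jetPair (X 1) (slash (Y 0)) z + jetPair (X 0) (slash (Y 1)) z) +
      jetPair (X 2) (slash (Y 2)) z) -
    ((jetPair (slash (X 0)) (Y 1) z + jetPair (slash (X 1)) (Y 0) z) +
      jetPair (slash (X 2)) (Y 2) z) with hR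
  have hconst : ∀ z : ℂ, 0 < z.im →
      HasDerivAt (fun z => L (-1 / (3 * z)) - L z - R z) 0 z := by
    intro z hz
    have hw := im_neg_one_div_three hz
    have hS := fun i => (hX.jet i).slash
    have hS' := fun i => (hY.jet i).slash
    have hRd := ((((hX.jet 1).hasDerivAt_jetPair (hS' 0) hz).add
      ((hX.jet 0).hasDerivAt_jetPair (hS' 1) hz)).add
      ((hX.jet 2).hasDerivAt_jetPair (hS' 2) hz)).sub
      ((((hS 0).hasDerivAt_jetPair (hY.jet 1) hz).add
      ((hS 1).hasDerivAt_jetPair (hY.jet 0) hz)).add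
      ((hS 2).hasDerivAt_jetPair (hY.jet 2) hz))
    have h := (((hLd _ hw).comp_fricke hz).sub (hLd z hz)).sub hRd
    refine h.congr_deriv ?_
    obtain ⟨x0, x1, x2⟩ := hX.slash_third hz
    obtain ⟨y0, y1, y2⟩ := hY.slash_third hz
    rw [x0, x1, x2, y0, y1, y2, hX.fricke_zero z hz, hX.fricke_one z hz, hX.fricke_two z hz,
      hY.fricke_zero z hz, hY.fricke_one z hz, hY.fricke_two z hz]
    simp only [slash]
    have h0 := ne_zero_of_im_pos hz
    generalize X 0 0 (-1 / (3 * z)) = p0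
    generalize X 1 0 (-1 / (3 * z)) = p1
    generalize X 2 0 (-1 / (3 * z)) = p2
    generalize Y 0 0 (-1 / (3 * z)) = q0
    generalize Y 1 0 (-1 / (3 * z)) = q1
    generalize Y 2 0 (-1 / (3 * z)) = q2
    field_simp
    ring
  have hz := ellipticPt_im
  have hw := ellipticPt_sub_one_im
  have hval := const_of_deriv_zero hconst ellipticPt_im frickePt_im
  have hR0 : R frickePt = 0 := by
    simp only [hR, jetPair_slash_frickePt]
    ring
  simp only [fricke_frickePt, fricke_ellipticPt, hR0, sub_self] at hval
  have hLe := hLT _ hw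
  rw [sub_add_cancel] at hLe
  have hr : -2 * r = R ellipticPt := by
    linear_combination hval + hLe
  have key : ∀ {Z : Fin 3 → ℕ → ℂ → ℂ}, EichlerTriple Z → ∀ j < 3,
      Z 0 j (ellipticPt - 1) = Z 0 j ellipticPt ∧
      Z 1 j (ellipticPt - 1) = -Z 0 j ellipticPt - Z 1 j ellipticPt ∧
      Z 2 j (ellipticPt - 1) = Z 1 j ellipticPt ∧
      Z 2 j ellipticPt = -Z 0 j ellipticPt - Z 1 j ellipticPt := by
    intro Z hZ j hj
    have hs : Z 2 j ellipticPt = -Z 0 j ellipticPt - Z 1 j ellipticPt := by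
      linear_combination hZ.sum_eq_zero j hj _ hz
    refine ⟨?_, ?_, ?_, hs⟩
    · rw [← hZ.add_one_zero j hj _ hw, sub_add_cancel]
    · rw [← hZ.add_one_two j hj _ hw, sub_add_cancel, hs]
    · rw [← hZ.add_one_one j hj _ hw, sub_add_cancel]
  have half : ∀ {a b : ℂ}, 2 * a = b → a = b / 2 := fun h => by linear_combination h / 2
  obtain ⟨x2, x1, x0⟩ := hX.jet_ellipticPt
  obtain ⟨y2, y1, y0⟩ := hY.jet_ellipticPt
  obtain ⟨a0, b0, c0, d0⟩ := key hX 0 (by norm_num)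
  obtain ⟨a1, b1, c1, d1⟩ := key hX 1 (by norm_num)
  obtain ⟨a2, b2, c2, d2⟩ := key hX 2 (by norm_num)
  obtain ⟨a0', b0', c0', d0'⟩ := key hY 0 (by norm_num)
  obtain ⟨a1', b1', c1', d1'⟩ := key hY 1 (by norm_num)
  obtain ⟨a2', b2', c2', d2'⟩ := key hY 2 (by norm_num)
  simp only [hR, jetPair, (slash_ellipticPt _).1, (slash_ellipticPt _).2.1,
    (slash_ellipticPt _).2.2, a0, b0, c0, d0, a1, b1, c1, d1, a2, b2, c2, d2, a0', b0', c0', d0',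
    a1', b1', c1', d1', a2', b2', c2', d2', half x0, half x1, half x2, half y0, half y1,
    half y2] at hr
  linear_combination (-1 / 2) * hr +
    (27 * (X 0 1 ellipticPt * Y 0 0 ellipticPt - X 0 0 ellipticPt * Y 0 1 ellipticPt) +
      27 / 4 * (X 0 2 ellipticPt * Y 0 1 ellipticPt - X 0 1 ellipticPt * Y 0 2 ellipticPt)) *
      ellipticPt_sq

end EichlerTriple

/-- The three conjugates `A(z)`, `2B(z/2)`, `2B((z+1)/2)` and their derivatives. -/
noncomputable def halfTriple (A B : ℕ → ℂ → ℂ) : Fin 3 → ℕ → ℂ → ℂ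
  | 0 => A
  | 1 => fun j z => 2 / 2 ^ j * B j (z / 2)
  | 2 => fun j z => 2 / 2 ^ j * B j ((z + 1) / 2)

lemma HasDerivAt.comp_half {f : ℂ → ℂ} {f' z : ℂ} (hf : HasDerivAt f f' (z / 2)) :
    HasDerivAt (fun w : ℂ => f (w / 2)) (f' / 2) z := by
  have h := HasDerivAt.comp z hf ((hasDerivAt_id z).div_const 2)
  refine h.congr_deriv ?_
  ring

lemma HasDerivAt.comp_half_add {f : ℂ → ℂ} {f' z : ℂ} (hf : HasDerivAt f f' ((z + 1) / 2)) :
    HasDerivAt (fun w : ℂ => f ((w + 1) / 2)) (f' / 2) z := by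
  have h := HasDerivAt.comp z hf (((hasDerivAt_id z).add_const 1).div_const 2)
  refine h.congr_deriv ?_
  ring

lemma IsJet.half {x : ℕ → ℂ → ℂ} (hx : IsJet x) : IsJet (fun j z => 2 / 2 ^ j * x j (z / 2)) where
  deriv_zero z hz :=
    ((hx.deriv_zero _ (im_half' hz)).comp_half.const_mul _).congr_deriv (by ring)
  deriv_one z hz :=
    ((hx.deriv_one _ (im_half' hz)).comp_half.const_mul _).congr_deriv (by ring)
  deriv_two z hz :=
    ((hx.deriv_two _ (im_half' hz)).comp_half.const_mul _).congr_deriv (by ring)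

lemma IsJet.half_add {x : ℕ → ℂ → ℂ} (hx : IsJet x) :
    IsJet (fun j z => 2 / 2 ^ j * x j ((z + 1) / 2)) where
  deriv_zero z hz :=
    ((hx.deriv_zero _ (im_half hz)).comp_half_add.const_mul _).congr_deriv (by ring)
  deriv_one z hz :=
    ((hx.deriv_one _ (im_half hz)).comp_half_add.const_mul _).congr_deriv (by ring)
  deriv_two z hz :=
    ((hx.deriv_two _ (im_half hz)).comp_half_add.const_mul _).congr_deriv (by ring)

lemma IsJet.add {x y : ℕ → ℂ → ℂ} (hx : IsJet x) (hy : IsJet y) :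
    IsJet (fun j z => x j z + y j z) where
  deriv_zero z hz := (hx.deriv_zero z hz).add (hy.deriv_zero z hz)
  deriv_one z hz := (hx.deriv_one z hz).add (hy.deriv_one z hz)
  deriv_two z hz := (hx.deriv_two z hz).add (hy.deriv_two z hz)

lemma IsJet.eq_zero {x : ℕ → ℂ → ℂ} (hx : IsJet x) (hb : ∀ j < 3, NomeBound (x j))
    (h3 : ∀ z : ℂ, 0 < z.im → x 3 z = 0) : ∀ j < 3, ∀ z : ℂ, 0 < z.im → x j z = 0 := by
  have e2 : ∀ z : ℂ, 0 < z.im → x 2 z = 0 := fun z hz =>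
    (hb 2 (by norm_num)).eq_zero (fun w hw => h3 w hw ▸ hx.deriv_two w hw) hz
  have e1 : ∀ z : ℂ, 0 < z.im → x 1 z = 0 := fun z hz =>
    (hb 1 (by norm_num)).eq_zero (fun w hw => e2 w hw ▸ hx.deriv_one w hw) hz
  have e0 : ∀ z : ℂ, 0 < z.im → x 0 z = 0 := fun z hz =>
    (hb 0 (by norm_num)).eq_zero (fun w hw => e1 w hw ▸ hx.deriv_zero w hw) hz
  intro j hj
  interval_cases j
  exacts [e0, e1, e2]

lemma eichlerTriple_halfTriple {A B : ℕ → ℂ → ℂ} (hA : IsJet A) (hB : IsJet B)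
    (hAT : ∀ j < 3, ∀ z : ℂ, 0 < z.im → A j (z + 1) = A j z)
    (hBT : ∀ j < 3, ∀ z : ℂ, 0 < z.im → B j (z + 1) = B j z)
    (hAb : ∀ j < 3, NomeBound (A j))
    (hBb : ∀ j < 3, NomeBound (fun z => B j (z / 2) + B j ((z + 1) / 2)))
    (htr : ∀ z : ℂ, 0 < z.im → 4 * A 3 z + (B 3 (z / 2) + B 3 ((z + 1) / 2)) = 0)
    (hAB : ∀ z : ℂ, 0 < z.im → A 3 (-1 / (6 * z)) = 36 * z ^ 4 * B 3 z)
    (hBA : ∀ z : ℂ, 0 < z.im → B 3 (-1 / (6 * z)) = 36 * z ^ 4 * A 3 z)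
    (hBB : ∀ z : ℂ, 0 < z.im → B 3 ((-1 / (3 * z) + 1) / 2) = 9 * z ^ 4 * B 3 ((z + 1) / 2)) :
    EichlerTriple (halfTriple A B) where
  jet i := by
    fin_cases i
    exacts [hA, hB.half, hB.half_add]
  add_one_zero := hAT
  add_one_one j _ z _ := rfl
  add_one_two j hj z hz := by
    simp only [halfTriple]
    rw [show (z + 1 + 1) / 2 = z / 2 + 1 by ring, hBT j hj _ (im_half' hz)]
  sum_eq_zero := by
    refine IsJet.eq_zero (x := fun j z => halfTriple A B 0 j z + halfTriple A B 1 j z +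
      halfTriple A B 2 j z) ((hA.add hB.half).add hB.half_add) (fun j hj => ?_) (fun z hz => ?_)
    · refine ((hAb j hj).add ((hBb j hj).const_mul (2 / 2 ^ j))).congr fun z _ => ?_
      simp only [halfTriple]
      ring
    · simp only [halfTriple]
      linear_combination htr z hz / 4
  fricke_zero z hz := by
    simp only [halfTriple]
    rw [(fricke_half_args hz).1, hAB _ (im_half' hz)]
    ring
  fricke_one z hz := by
    simp only [halfTriple]
    rw [(fricke_half_args hz).2, hBA z hz]
    ring
  fricke_two z hz := by
    simp only [halfTriple]
    rw [hBB z hz]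
    ring

/-- Three iterated primitives of a cuspidal series. -/
lemma CuspSeries.exists_jet {φ : ℂ → ℂ} {a : ℂ} (h : CuspSeries φ a) :
    ∃ x : ℕ → ℂ → ℂ, IsJet x ∧ x 3 = φ ∧ CuspSeries (x 0) (a / (2 * π * I) ^ 3) ∧
      ∀ j < 3, ∃ b, CuspSeries (x j) b := by
  obtain ⟨x2, c2, h2⟩ := h.exists_primitive
  obtain ⟨x1, c1, h1⟩ := c2.exists_primitive
  obtain ⟨x0, c0, h0⟩ := c1.exists_primitive
  refine ⟨fun | 0 => x0 | 1 => x1 | 2 => x2 | _ => φ, ⟨h0, h1, h2⟩, rfl, ?_, ?_⟩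
  · have e : a / (2 * π * I) ^ 3 = a / (2 * π * I) / (2 * π * I) / (2 * π * I) := by
      rw [div_div, div_div, pow_succ, pow_two, mul_assoc (2 * π * I : ℂ)]
    exact e ▸ c0
  · intro j hj
    interval_cases j
    exacts [⟨_, c0⟩, ⟨_, c1⟩, ⟨_, c2⟩]

/-- The polar part of `k46` and its iterated primitives. -/
noncomputable def poleJet (j : ℕ) (z : ℂ) : ℂ :=
  1 / 8 * (-(2 * π * I)⁻¹) ^ (3 - j) * (nome z)⁻¹

lemma hasDerivAt_nome_inv (z : ℂ) :
    HasDerivAt (fun z => (nome z)⁻¹) (-(2 * π * I) * (nome z)⁻¹) z := by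
  refine (hasDerivAt_nome z).inv (nome_ne_zero z) |>.congr_deriv ?_
  have := nome_ne_zero z
  field_simp

lemma isJet_poleJet : IsJet poleJet := by
  have h0 : (2 * π * I : ℂ) ≠ 0 := two_pi_I_ne_zero
  have key : ∀ n : ℕ, ∀ z, HasDerivAt (fun z => 1 / 8 * (-(2 * π * I : ℂ)⁻¹) ^ (n + 1) * (nome z)⁻¹)
      (1 / 8 * (-(2 * π * I : ℂ)⁻¹) ^ n * (nome z)⁻¹) z := fun n z => by
    refine ((hasDerivAt_nome_inv z).const_mul _).congr_deriv ?_
    rw [pow_succ]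
    generalize (2 * π * I : ℂ) = t at *
    field_simp
  exact ⟨fun z _ => key 2 z, fun z _ => key 1 z, fun z _ => key 0 z⟩

lemma poleJet_half_sum (j : ℕ) (z : ℂ) : poleJet j (z / 2) + poleJet j ((z + 1) / 2) = 0 := by
  simp only [poleJet, nome_half, inv_neg]
  ring

lemma poleJet_add_one (j : ℕ) (z : ℂ) : poleJet j (z + 1) = poleJet j z := by
  simp only [poleJet, nome_add_one]

/-- The Legendre relation between the primitives of `f46` and `g46` at the elliptic point. -/
lemma exists_legendre_jets : ∃ F G : ℕ → ℂ → ℂ, IsJet F ∧ IsJet G ∧ F 3 = f46 ∧ G 3 = g46 ∧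
    (∀ j < 3, NomeBound (F j)) ∧ (∀ j < 3, NomeBound (G j)) ∧
    1 / 8 / (2 * π * I) ^ 3 = 3 * (F 2 ellipticPt * G 1 ellipticPt -
      F 1 ellipticPt * G 2 ellipticPt) := by
  obtain ⟨F, hF, hF3, hF0, hFc⟩ := cuspSeries_f46.exists_jet
  obtain ⟨G, hG, hG3, -, hGc⟩ := cuspSeries_g46.exists_jet
  obtain ⟨K, hK, hK3, -, hKc⟩ := cuspSeries_k46Reg.exists_jet
  have bound : ∀ {x : ℕ → ℂ → ℂ}, (∀ j < 3, ∃ b, CuspSeries (x j) b) → ∀ j < 3, NomeBound (x j) :=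
    fun h j hj => (h j hj).choose_spec.nomeBound
  have per : ∀ {x : ℕ → ℂ → ℂ}, (∀ j < 3, ∃ b, CuspSeries (x j) b) → ∀ j < 3, ∀ z : ℂ, 0 < z.im →
      x j (z + 1) = x j z := fun h j hj z hz => (h j hj).choose_spec.add_one hz
  refine ⟨F, G, hF, hG, hF3, hG3, bound hFc, bound hGc, ?_⟩
  have hk3 : ∀ z : ℂ, 0 < z.im → poleJet 3 z + K 3 z = k46 z := fun z hz => by
    rw [k46_eq_add_reg hz, hK3, poleJet]
    norm_num
  have hY : EichlerTriple (halfTriple F F) := by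
    refine eichlerTriple_halfTriple hF hF (per hFc) (per hFc) (bound hFc)
      (fun j hj => (hFc j hj).choose_spec.half_sum) ?_ ?_ ?_ ?_ <;> rw [hF3] <;> intro z hz
    exacts [f46_trace hz, f46_fricke hz, f46_fricke hz, f46_half_fricke hz]
  have hX : EichlerTriple (halfTriple G (fun j z => poleJet j z + K j z)) := by
    refine eichlerTriple_halfTriple hG (isJet_poleJet.add hK) (per hGc) (fun j hj z hz => ?_)
      (bound hGc) (fun j hj => ?_) (fun z hz => ?_) (fun z hz => ?_) (fun z hz => ?_)
      (fun z hz => ?_)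
    · rw [poleJet_add_one, per hKc j hj z hz]
    · refine (hKc j hj).choose_spec.half_sum.congr fun z _ => ?_
      linear_combination poleJet_half_sum j z
    · rw [hk3 _ (im_half' hz), hk3 _ (im_half hz), hG3]
      exact gk46_trace hz
    · rw [hk3 z hz, hG3]
      exact g46_fricke hz
    · rw [hk3 _ (im_neg_one_div_six hz), hG3]
      exact k46_fricke hz
    · rw [hk3 _ (im_half hz), hk3 _ (im_half (im_neg_one_div_three hz))]
      exact k46_half_fricke hz
  obtain ⟨N, hN, hN'⟩ := (cuspSeries_g46.mul hF0).exists_primitive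
  set r : ℂ := 1 / 8 / (2 * π * I) ^ 3 with hr
  obtain ⟨c, M₀, hM₀, hM₀'⟩ : ∃ (c : ℂ) (M₀ : ℂ → ℂ), CuspSeries M₀ c ∧ ∀ z : ℂ, 0 < z.im →
      HasDerivAt M₀ (k46 z * F 0 z - r) z := by
    obtain ⟨Φ, hΦ, hΦ0, hΦe⟩ := id hF0
    have hΨ : CuspSeries (fun z => 1 / 8 * (nome z * dslope Φ 0 (nome z))) (1 / 8 * dslope Φ 0 0) :=
      ⟨fun q => 1 / 8 * dslope Φ 0 q, (differentiableOn_dslope_zero hΦ).const_mul _, rfl,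
        fun z _ => by ring⟩
    obtain ⟨M₀, hM₀, hd⟩ := (hΨ.add (cuspSeries_k46Reg.mul hF0)).exists_primitive
    refine ⟨_, M₀, hM₀, fun z hz => (hd z hz).congr_deriv ?_⟩
    rw [k46_eq_add_reg hz]
    have h1 := hΦe z hz
    have h2 := eq_add_mul_dslope Φ (nome z)
    have h3 : (nome z)⁻¹ * F 0 z = Φ (nome z) := by
      rw [h1, inv_mul_cancel_left₀ (nome_ne_zero z)]
    have h4 : r = 1 / 8 * Φ 0 := by rw [hΦ0, hr]; ring
    rw [h4]
    linear_combination (-1 / 8) * h3 - 1 / 8 * h2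
  have hM' : ∀ z : ℂ, 0 < z.im → HasDerivAt (fun z => M₀ z + r * z) (k46 z * F 0 z) z :=
    fun z hz => ((hM₀' z hz).add ((hasDerivAt_id z).const_mul r)).congr_deriv (by ring)
  have hper := hX.period_eq hY (r := r)
    (Ω := fun z => N z + (M₀ (z / 2) + r * (z / 2)) + (M₀ ((z + 1) / 2) + r * ((z + 1) / 2)))
    (fun z hz => ?_) (fun z hz => ?_)
  · exact hper
  · refine (((hN' z hz).add (hM' _ (im_half' hz)).comp_half).add
      (hM' _ (im_half hz)).comp_half_add).congr_deriv ?_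
    simp only [halfTriple, hG3, hk3 _ (im_half' hz), hk3 _ (im_half hz)]
    ring
  · have e : M₀ ((z + 1 + 1) / 2) = M₀ (z / 2) := by
      rw [show (z + 1 + 1) / 2 = z / 2 + 1 by ring, hM₀.add_one (im_half' hz)]
    simp only [hN.add_one hz, e]
    ring

lemma im_vertical {y : ℝ} : ((1 + I * (y : ℂ)) / 2).im = y / 2 := by
  rw [show (1 + I * (y : ℂ)) / 2 = ((1 / 2 : ℝ) : ℂ) + ((y / 2 : ℝ) : ℂ) * I by push_cast; ring]
  simp [-one_div]

lemma NomeBound.isBigO_vertical {φ : ℂ → ℂ} (h : NomeBound φ) {k : ℕ} (hk : k ≤ 1) :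
    (fun y : ℝ => φ ((1 + I * (y : ℂ)) / 2) * (y : ℂ) ^ k) =O[atTop]
      fun y : ℝ => Real.exp (-1 * y) := by
  obtain ⟨C, A, hC, hb⟩ := h
  refine Asymptotics.IsBigO.of_bound C ?_
  filter_upwards [eventually_ge_atTop (2 * A), eventually_ge_atTop 0] with y hy hy0
  have h1 := hb ((1 + I * (y : ℂ)) / 2) (by rw [im_vertical]; linarith)
  rw [norm_nome, im_vertical] at h1
  have h2 : ‖(y : ℂ) ^ k‖ ≤ Real.exp y := by
    rw [norm_pow, norm_real, Real.norm_of_nonneg hy0]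
    interval_cases k
    · simpa using hy0
    · linarith [Real.add_one_le_exp y]
  rw [norm_mul, Real.norm_of_nonneg (Real.exp_pos _).le]
  calc _ ≤ C * Real.exp (-(2 * π * (y / 2))) * Real.exp y := by gcongr
    _ = C * Real.exp (-(2 * π * (y / 2)) + y) := by rw [mul_assoc, ← Real.exp_add]
    _ ≤ C * Real.exp (-1 * y) := by
      gcongr
      nlinarith [Real.pi_gt_three]

lemma NomeBound.tendsto_vertical {φ : ℂ → ℂ} (h : NomeBound φ) {k : ℕ} (hk : k ≤ 1) :
    Tendsto (fun y : ℝ => φ ((1 + I * (y : ℂ)) / 2) * (y : ℂ) ^ k) atTop (𝓝 0) := by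
  refine (h.isBigO_vertical hk).trans_tendsto ?_
  refine Real.tendsto_exp_atBot.comp ?_
  exact tendsto_id.const_mul_atTop_of_neg (by norm_num)

lemma HasDerivAt.comp_vertical {f : ℂ → ℂ} {f' : ℂ} {y : ℝ}
    (hf : HasDerivAt f f' ((1 + I * (y : ℂ)) / 2)) :
    HasDerivAt (fun y : ℝ => f ((1 + I * (y : ℂ)) / 2)) (f' * (I / 2)) y := by
  have h : HasDerivAt (fun w : ℂ => (1 + I * w) / 2) (I / 2) (y : ℂ) := by
    simpa using (((hasDerivAt_id (y : ℂ)).const_mul I).const_add 1).div_const 2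
  exact (HasDerivAt.comp (y : ℂ) hf h).comp_ofReal

/-- The integrals of a form along the vertical half-line in terms of its primitives. -/
lemma IsJet.integral_vertical {x : ℕ → ℂ → ℂ} (hx : IsJet x) (hb : ∀ j < 3, NomeBound (x j))
    (h3 : NomeBound (x 3)) (hd : ∀ z : ℂ, 0 < z.im → DifferentiableAt ℂ (x 3) z) :
    -(∫ y in Ioi (1 / Real.sqrt 3), x 3 ((1 + I * (y : ℂ)) / 2) * (y : ℂ) ^ 0) =
        -2 * I * x 2 ellipticPt ∧
    -(∫ y in Ioi (1 / Real.sqrt 3), x 3 ((1 + I * (y : ℂ)) / 2) * (y : ℂ) ^ 1) =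
        -2 * I * ((1 / Real.sqrt 3 : ℝ) : ℂ) * x 2 ellipticPt + 4 * x 1 ellipticPt := by
  have hpos : ∀ y ∈ Ici (1 / Real.sqrt 3), 0 < ((1 + I * (y : ℂ)) / 2).im := fun y hy => by
    have : 0 < 1 / Real.sqrt 3 := by positivity
    rw [im_vertical]
    linarith [mem_Ici.1 hy]
  have integrable_form : ∀ k ≤ 1, MeasureTheory.IntegrableOn
      (fun y : ℝ => x 3 ((1 + I * (y : ℂ)) / 2) * (y : ℂ) ^ k) (Ioi (1 / Real.sqrt 3)) := by
    intro k hk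
    have hc : ContinuousOn (fun y : ℝ => x 3 ((1 + I * (y : ℂ)) / 2) * (y : ℂ) ^ k)
        (Ici (1 / Real.sqrt 3)) := fun y hy =>
      (((hd _ (hpos y hy)).hasDerivAt.comp_vertical).continuousAt.mul
        (by fun_prop)).continuousWithinAt
    refine MeasureTheory.IntegrableOn.mono_set ?_ Ioi_subset_Ici_self
    exact (hc.locallyIntegrableOn measurableSet_Ici).integrableOn_of_isBigO_atTop
      (h3.isBigO_vertical hk) ⟨Ioi 1, Ioi_mem_atTop 1, exp_neg_integrableOn_Ioi 1 one_pos⟩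
  have t2 := fun {k : ℕ} (hk : k ≤ 1) => (hb 2 (by norm_num)).tendsto_vertical hk
  have t1 := fun {k : ℕ} (hk : k ≤ 1) => (hb 1 (by norm_num)).tendsto_vertical hk
  constructor
  · rw [MeasureTheory.integral_Ioi_of_hasDerivAt_of_tendsto'
      (f := fun y : ℝ => -2 * I * (x 2 ((1 + I * (y : ℂ)) / 2) * (y : ℂ) ^ 0)) (m := 0)
      (fun y hy => ?_) (integrable_form 0 zero_le_one) ?_]
    · simp only [pow_zero, mul_one, ellipticPt]
      ring
    · simpa using (t2 zero_le_one).const_mul (-2 * I)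
    · simp only [pow_zero, mul_one]
      refine ((hx.deriv_two _ (hpos y hy)).comp_vertical.const_mul (-2 * I)).congr_deriv ?_
      linear_combination (-x 3 ((1 + I * (y : ℂ)) / 2)) * I_sq
  · rw [MeasureTheory.integral_Ioi_of_hasDerivAt_of_tendsto'
      (f := fun y : ℝ => -2 * I * (x 2 ((1 + I * (y : ℂ)) / 2) * (y : ℂ) ^ 1) +
        4 * (x 1 ((1 + I * (y : ℂ)) / 2) * (y : ℂ) ^ 0)) (m := 0)
      (fun y hy => ?_) (integrable_form 1 le_rfl) ?_]
    · simp only [pow_zero, mul_one, pow_one, ellipticPt]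
      ring
    · simpa using ((t2 le_rfl).const_mul (-2 * I)).add ((t1 zero_le_one).const_mul 4)
    · simp only [pow_zero, mul_one, pow_one]
      have hid : HasDerivAt (fun y : ℝ => (y : ℂ)) 1 y := (hasDerivAt_id (y : ℂ)).comp_ofReal
      refine ((((hx.deriv_two _ (hpos y hy)).comp_vertical.mul hid).const_mul (-2 * I)).add
        ((hx.deriv_one _ (hpos y hy)).comp_vertical.const_mul 4)).congr_deriv ?_
      linear_combination (-x 3 ((1 + I * (y : ℂ)) / 2) * y) * I_sq

/-- The Legendre-type relation `D₁E₂ - D₂E₁ = 1/(24π³)` between periods and quasi-periods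
of the weight-4 level-6 modular forms. -/
theorem legendre_relation_weight4 :
    D 1 * E 2 - D 2 * E 1 = 1 / (24 * (π : ℂ) ^ 3) := by
  obtain ⟨F, G, hF, hG, hF3, hG3, hFb, hGb, hrel⟩ := exists_legendre_jets
  obtain ⟨d1, d2⟩ := hF.integral_vertical hFb (hF3 ▸ cuspSeries_f46.nomeBound)
    (fun z hz => hF3 ▸ cuspSeries_f46.differentiableAt hz)
  obtain ⟨e1, e2⟩ := hG.integral_vertical hGb (hG3 ▸ cuspSeries_g46.nomeBound)
    (fun z hz => hG3 ▸ cuspSeries_g46.differentiableAt hz)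
  rw [hF3] at d1 d2
  rw [hG3] at e1 e2
  rw [show D 1 = _ from d1, show D 2 = _ from d2, show E 1 = _ from e1, show E 2 = _ from e2]
  have hpi : (π : ℂ) ≠ 0 := ofReal_ne_zero.2 Real.pi_ne_zero
  have hr : 1 / 8 / (2 * π * I) ^ 3 = I / (64 * (π : ℂ) ^ 3) := by
    field_simp
    linear_combination 64 * (1 - I ^ 2) * I_sq
  rw [hr] at hrel
  have hfin : 1 / (24 * (π : ℂ) ^ 3) = -8 / 3 * I * (I / (64 * (π : ℂ) ^ 3)) := by
    field_simp
    linear_combination 192 * I_sq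
  rw [hfin, hrel]
  ring
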